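/- arXiv:1209.3123 — 4 statements merged into one kernel-verified Lean document; each statement's English description precedes it below -/
import Mathlib

section
/- Let A = ⋃_{j=1}^{N} {x ∈ ℝ^n : q_{j,1federal}(x) ≥ 0, …, q_{j,m_j}(x) ≥ 0} be a closed semialgebraic set given by finitely many real polynomial inequalities. Assume 0 ∈ A, 0 is not an isolated point of A, and A has empty interior in ℝ^n (codimension ≥ 1). Then for every real s ≥ 1 there exists a real polynomial P ∈ ℝ[x_1,…,x_n] with P(0) = 0 such that, setting Y = P^{-1}(0), 0 is not isolated in Y, the intersections A ∩ S_r and Y ∩ S_r are nonempty for all sufficiently small r > 0, and lim_{r→0⁺} D(A ∩ S_r, Y ∩ S_r)/r^s = 0, where S_r denotes the sphere in ℝ^n of radius r centered at 0 and D denotes the Hausdorff distance between nonempty compact sets. -/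
open Metric Filter Set

section CauchyIndex

open Polynomial

/-- Half of the jump of the sign of `g` at `x`. -/
noncomputable def signJump (g : ℝ[X]) (x : ℝ) : ℤ :=
  if Odd (rootMultiplicity x g) then
    (SignType.sign (eval x (g /ₘ (X - C x) ^ rootMultiplicity x g)) : ℤ) else 0

lemma exists_eq_X_sub_C_pow_mul {g : ℝ[X]} (hg : g ≠ 0) (x : ℝ) :
    ∃ (k : ℕ) (h : ℝ[X]), g = (X - C x) ^ k * h ∧ eval x h ≠ 0 :=
  ⟨_, _, (pow_mul_divByMonic_rootMultiplicity_eq g x).symm,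
    eval_divByMonic_pow_rootMultiplicity_ne_zero x hg⟩

lemma rootMultiplicity_X_sub_C_pow_mul {h : ℝ[X]} {x : ℝ} (k : ℕ) (hh : eval x h ≠ 0) :
    rootMultiplicity x ((X - C x) ^ k * h) = k := by
  have h0 : h ≠ 0 := by rintro rfl; simp at hh
  rw [mul_comm, rootMultiplicity_mul_X_sub_C_pow h0, rootMultiplicity_eq_zero hh, zero_add]

lemma signJump_X_sub_C_pow_mul {h : ℝ[X]} {x : ℝ} (k : ℕ) (hh : eval x h ≠ 0) :
    signJump ((X - C x) ^ k * h) x = if Odd k then (SignType.sign (eval x h) : ℤ) else 0 := by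
  rw [signJump, rootMultiplicity_X_sub_C_pow_mul k hh,
    mul_divByMonic_cancel_left _ ((monic_X_sub_C x).pow k)]

/-- The contribution of `x` to the Cauchy index of `f / p`. -/
noncomputable def cauchyTerm (f p : ℝ[X]) (x : ℝ) : ℤ :=
  if rootMultiplicity x f < rootMultiplicity x p then signJump (f * p) x else 0

/-- The Cauchy index of the rational function `f / p` on the real line. -/
noncomputable def cauchyIndex (f p : ℝ[X]) : ℤ :=
  ∑ x ∈ p.roots.toFinset, cauchyTerm f p x

lemma cauchyTerm_X_sub_C_pow_mul {u v : ℝ[X]} {x : ℝ} (j k : ℕ) (hu : eval x u ≠ 0)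
    (hv : eval x v ≠ 0) :
    cauchyTerm ((X - C x) ^ j * u) ((X - C x) ^ k * v) x =
      if j < k ∧ Odd (j + k) then (SignType.sign (eval x u * eval x v) : ℤ) else 0 := by
  have e : (X - C x) ^ j * u * ((X - C x) ^ k * v) = (X - C x) ^ (j + k) * (u * v) := by ring
  rw [cauchyTerm, rootMultiplicity_X_sub_C_pow_mul j hu, rootMultiplicity_X_sub_C_pow_mul k hv, e,
    signJump_X_sub_C_pow_mul _ (by simp [hu, hv]), eval_mul]
  split_ifs <;> first | rfl | (exfalso; tauto)

lemma cauchyTerm_eq_zero_of_dvd {f v : ℝ[X]} {x : ℝ} (k : ℕ) (hv : eval x v ≠ 0)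
    (hf : (X - C x) ^ k ∣ f) : cauchyTerm f ((X - C x) ^ k * v) x = 0 := by
  obtain ⟨u, rfl⟩ := hf
  by_cases hu : u = 0
  · simp [cauchyTerm, signJump, hu]
  · obtain ⟨j, w, rfl, hw⟩ := exists_eq_X_sub_C_pow_mul hu x
    rw [← mul_assoc, ← pow_add, cauchyTerm_X_sub_C_pow_mul _ _ hw hv, if_neg (by omega)]

lemma cauchyIndex_zero_right (f : ℝ[X]) : cauchyIndex f 0 = 0 := by simp [cauchyIndex]

lemma cauchyIndex_zero_left (p : ℝ[X]) : cauchyIndex 0 p = 0 := by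
  simp [cauchyIndex, cauchyTerm, signJump]

lemma cauchyTerm_add_mul (f p c : ℝ[X]) (hp : p ≠ 0) (x : ℝ) :
    cauchyTerm (f + c * p) p x = cauchyTerm f p x := by
  obtain ⟨k, v, rfl, hv⟩ := exists_eq_X_sub_C_pow_mul hp x
  by_cases hf : (X - C x) ^ k ∣ f
  · rw [cauchyTerm_eq_zero_of_dvd k hv hf, cauchyTerm_eq_zero_of_dvd k hv]
    exact dvd_add hf (Dvd.dvd.mul_left (Dvd.intro _ rfl) _)
  · have hf0 : f ≠ 0 := by rintro rfl; simp at hf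
    obtain ⟨j, u, rfl, hu⟩ := exists_eq_X_sub_C_pow_mul hf0 x
    have hjk : j < k := by
      by_contra hjk
      exact hf (Dvd.dvd.mul_right (pow_dvd_pow _ (by omega)) _)
    obtain ⟨d, rfl⟩ := Nat.exists_eq_add_of_lt hjk
    have e : (X - C x) ^ j * u + c * ((X - C x) ^ (j + d + 1) * v) =
        (X - C x) ^ j * (u + (X - C x) * ((X - C x) ^ d * c * v)) := by ring
    have e' : eval x (u + (X - C x) * ((X - C x) ^ d * c * v)) = eval x u := by simp
    rw [e, cauchyTerm_X_sub_C_pow_mul _ _ (by rwa [e']) hv, e',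
      cauchyTerm_X_sub_C_pow_mul _ _ hu hv]

lemma cauchyIndex_add_mul (f p c : ℝ[X]) : cauchyIndex (f + c * p) p = cauchyIndex f p := by
  by_cases hp : p = 0
  · simp [hp]
  · exact Finset.sum_congr rfl fun x _ => cauchyTerm_add_mul f p c hp x

lemma cauchyIndex_C_mul (f p : ℝ[X]) {a : ℝ} (ha : 0 < a) :
    cauchyIndex (C a * f) p = cauchyIndex f p := by
  by_cases hp : p = 0
  · simp [hp, cauchyIndex_zero_right]
  by_cases hf : f = 0
  · simp [hf]
  refine Finset.sum_congr rfl fun x _ => ?_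
  obtain ⟨k, v, rfl, hv⟩ := exists_eq_X_sub_C_pow_mul hp x
  obtain ⟨j, u, rfl, hu⟩ := exists_eq_X_sub_C_pow_mul hf x
  have e : C a * ((X - C x) ^ j * u) = (X - C x) ^ j * (C a * u) := by ring
  rw [e, cauchyTerm_X_sub_C_pow_mul _ _ (by simp [hu, ha.ne']) hv,
    cauchyTerm_X_sub_C_pow_mul _ _ hu hv]
  simp only [eval_mul, eval_C, mul_assoc, sign_mul, sign_pos ha, one_mul]

lemma cauchyTerm_add_swap (f p : ℝ[X]) (hf : f ≠ 0) (hp : p ≠ 0) (x : ℝ) :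
    cauchyTerm f p x + cauchyTerm p f x = signJump (f * p) x := by
  obtain ⟨k, v, rfl, hv⟩ := exists_eq_X_sub_C_pow_mul hp x
  obtain ⟨j, u, rfl, hu⟩ := exists_eq_X_sub_C_pow_mul hf x
  have e : (X - C x) ^ j * u * ((X - C x) ^ k * v) = (X - C x) ^ (j + k) * (u * v) := by ring
  rw [cauchyTerm_X_sub_C_pow_mul _ _ hu hv, cauchyTerm_X_sub_C_pow_mul _ _ hv hu, e,
    signJump_X_sub_C_pow_mul _ (by simp [hu, hv]), eval_mul, mul_comm (eval x v), add_comm k j]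
  by_cases ho : Odd (j + k)
  · rcases lt_trichotomy j k with h | h | h
    · simp [ho, h, h.not_gt]
    · subst h
      exact absurd ho (by grind)
    · simp [ho, h, h.not_gt]
  · simp [ho]

lemma cauchyIndex_add_swap (f p : ℝ[X]) (hf : f ≠ 0) (hp : p ≠ 0) :
    cauchyIndex f p + cauchyIndex p f = ∑ x ∈ (f * p).roots.toFinset, signJump (f * p) x := by
  have key : ∀ f p : ℝ[X], f ≠ 0 → p ≠ 0 →
      cauchyIndex f p = ∑ x ∈ (f * p).roots.toFinset, cauchyTerm f p x := by
    intro f p hf hp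
    refine Finset.sum_subset (fun x hx => ?_) fun x _ hx => ?_
    · have : eval x p = 0 := (mem_roots hp).1 (Multiset.mem_toFinset.1 hx)
      simp [hf, hp, this]
    · have : ¬ IsRoot p x := by simpa [hp] using hx
      simp [cauchyTerm, rootMultiplicity_eq_zero this]
  rw [key f p hf hp, key p f hp hf, mul_comm p f, ← Finset.sum_add_distrib]
  exact Finset.sum_congr rfl fun x _ => cauchyTerm_add_swap f p hf hp x

lemma sign_eval_of_forall_not_root {h : ℝ[X]} {a : ℝ} (hr : ∀ x, a ≤ x → eval x h ≠ 0) :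
    SignType.sign (eval a h) = SignType.sign h.leadingCoeff := by
  have key : ∀ h : ℝ[X], (∀ x, a ≤ x → eval x h ≠ 0) → 0 < h.leadingCoeff → 0 < eval a h := by
    intro h hr hl
    by_contra hneg
    have hneg : eval a h < 0 := lt_of_le_of_ne (not_lt.1 hneg) (hr a le_rfl)
    by_cases hd : 0 < h.degree
    · have ht := h.tendsto_atTop_of_leadingCoeff_nonneg hd hl.le
      obtain ⟨b, hb, hab⟩ := ((ht.eventually_ge_atTop 0).and (eventually_ge_atTop a)).exists
      obtain ⟨c, hc, hc0⟩ := intermediate_value_Icc hab h.continuous.continuousOn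
        (show (0 : ℝ) ∈ Icc _ _ from ⟨hneg.le, hb⟩)
      exact hr c hc.1 hc0
    · rw [eq_C_of_degree_le_zero (not_lt.1 hd)] at hneg hl
      simp at hneg hl
      linarith
  have h0 : h ≠ 0 := by rintro rfl; exact hr a le_rfl (by simp)
  rcases lt_or_gt_of_ne (leadingCoeff_ne_zero.2 h0) with hl | hl
  · have := key (-h) (fun x hx => by simpa using hr x hx) (by simpa using hl)
    rw [sign_neg hl, sign_neg (by simpa using this)]
  · rw [sign_pos hl, sign_pos (key h hr hl)]

lemma sum_signJump (g : ℝ[X]) :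
    ∑ x ∈ g.roots.toFinset, signJump g x =
      if Odd g.natDegree then (SignType.sign g.leadingCoeff : ℤ) else 0 := by
  induction hn : g.natDegree using Nat.strong_induction_on generalizing g with
  | _ n ih =>
  subst hn
  by_cases hg : g = 0
  · simp [hg]
  by_cases hroots : g.roots.toFinset = ∅
  · rw [hroots, Finset.sum_empty]
    have hnr : ∀ x, eval x g ≠ 0 := by
      intro x hx
      have : x ∈ g.roots.toFinset := by simp [hg, hx]
      simp [hroots] at this
    rw [if_neg]
    intro hodd
    have h1 := sign_eval_of_forall_not_root (a := 0) fun x _ => hnr x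
    have h2 := sign_eval_of_forall_not_root (h := g.comp (-X)) (a := 0)
      fun x _ => by simpa using hnr (-x)
    have hl : (g.comp (-X)).leadingCoeff = -g.leadingCoeff := by
      rw [leadingCoeff_comp (by simp)]; simp [hodd.neg_one_pow]
    rw [hl, Left.sign_neg, ← h1] at h2
    have := hnr 0
    rcases lt_or_gt_of_ne this with h | h <;> simp [h, sign_pos, sign_neg] at h2
  · have hne := Finset.nonempty_iff_ne_empty.2 hroots
    obtain ⟨a, ha, hmax⟩ := Finset.exists_max_image _ id hne
    have har : IsRoot g a := by simpa [hg] using ha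
    obtain ⟨k, h, rfl, hh⟩ := exists_eq_X_sub_C_pow_mul hg a
    have h0 : h ≠ 0 := by rintro rfl; simp at hh
    have hk : k ≠ 0 := by rintro rfl; simp [hh] at har
    have hsign : SignType.sign (eval a h) = SignType.sign h.leadingCoeff := by
      refine sign_eval_of_forall_not_root fun x hx hx0 => ?_
      have := hmax x (by simp [hg, hx0])
      have : x = a := le_antisymm this hx
      exact hh (this ▸ hx0)
    have hdeg : ((X - C a) ^ k * h).natDegree = k + h.natDegree := by
      rw [natDegree_mul (pow_ne_zero _ (X_sub_C_ne_zero a)) h0]; simp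
    have hlc : ((X - C a) ^ k * h).leadingCoeff = h.leadingCoeff := by simp
    have hset : ((X - C a) ^ k * h).roots.toFinset = insert a h.roots.toFinset := by
      ext x; simp [hg, h0, hk, sub_eq_zero]
    have hnot : a ∉ h.roots.toFinset := by simp [hh]
    rw [hset, Finset.sum_insert hnot, signJump_X_sub_C_pow_mul _ hh, hsign, hdeg, hlc]
    have hrest : ∑ x ∈ h.roots.toFinset, signJump ((X - C a) ^ k * h) x =
        (-1) ^ k * ∑ x ∈ h.roots.toFinset, signJump h x := by
      rw [Finset.mul_sum]
      refine Finset.sum_congr rfl fun x hx => ?_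
      have hxa : x < a := by
        refine lt_of_le_of_ne (hmax x ?_) (by rintro rfl; exact hnot hx)
        rw [hset]; exact Finset.mem_insert_of_mem hx
      obtain ⟨j, w, rfl, hw⟩ := exists_eq_X_sub_C_pow_mul h0 x
      have e : (X - C a) ^ k * ((X - C x) ^ j * w) = (X - C x) ^ j * ((X - C a) ^ k * w) := by ring
      have hxa' : x - a < 0 := by linarith
      rw [e, signJump_X_sub_C_pow_mul _ hw, signJump_X_sub_C_pow_mul _
        (by simp [hw, hxa'.ne])]
      simp [sign_mul, sign_pow, sign_neg hxa']
    rw [hrest, ih h.natDegree (by rw [hdeg]; omega) h rfl]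
    rcases Nat.even_or_odd k with hke | hko
    · have : Odd (k + h.natDegree) ↔ Odd h.natDegree := by grind
      have h' : ¬ Odd k := by grind
      simp [hke.neg_one_pow, this, h']
    · have : Odd (k + h.natDegree) ↔ ¬ Odd h.natDegree := by grind
      by_cases hd : Odd h.natDegree
      · simp [hko.neg_one_pow, this, hko, hd]
      · simp [this, hko, hd]

lemma cauchyIndex_derivative_mul (p q : ℝ[X]) :
    cauchyIndex (derivative p * q) p =
      ∑ x ∈ p.roots.toFinset, (SignType.sign (eval x q) : ℤ) := by
  refine Finset.sum_congr rfl fun x hx => ?_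
  have hp : p ≠ 0 := by rintro rfl; simp at hx
  have hr : IsRoot p x := by simpa [hp] using hx
  obtain ⟨k, v, rfl, hv⟩ := exists_eq_X_sub_C_pow_mul hp x
  obtain _ | k := k
  · simp [hv] at hr
  have e : derivative ((X - C x) ^ (k + 1) * v) =
      (X - C x) ^ k * (C ((k : ℝ) + 1) * v + (X - C x) * derivative v) := by
    simp only [derivative_mul, derivative_pow, derivative_sub, derivative_X, derivative_C]
    simp
    ring
  by_cases hq : eval x q = 0
  · rw [cauchyTerm_eq_zero_of_dvd _ hv, hq]
    · simp
    · rw [e, pow_succ, mul_assoc]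
      refine mul_dvd_mul_left _ (Dvd.dvd.mul_left (dvd_iff_isRoot.2 hq) _)
  · have hk : (0 : ℝ) < (k : ℝ) + 1 := by positivity
    have e' : eval x ((C ((k : ℝ) + 1) * v + (X - C x) * derivative v) * q) =
        ((k : ℝ) + 1) * eval x v * eval x q := by simp
    rw [e, mul_assoc, cauchyTerm_X_sub_C_pow_mul _ _ (by rw [e']; simp [hk.ne', hv, hq]) hv, e',
      if_pos ⟨by omega, by grind⟩]
    rw [show ((k : ℝ) + 1) * eval x v * eval x q * eval x v =
      ((k : ℝ) + 1) * (eval x v ^ 2) * eval x q by ring, sign_mul, sign_pos (by positivity)]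
    simp

end CauchyIndex

section QuantifierElimination

open Polynomial

variable {Ω R α β γ : Type*} [CommRing R]

/-- `G` is a function of the signs of finitely many elements of `R`, where `R` acts as a ring of
real functions on `Ω` through `ev`. -/
def SignDetermined (ev : Ω → R →+* ℝ) (G : Ω → α) : Prop :=
  ∃ (κ : Type) (_ : Finite κ) (F : κ → R) (Φ : (κ → SignType) → α),
    ∀ ω, G ω = Φ fun k => SignType.sign (ev ω (F k))

namespace SignDetermined

variable {ev : Ω → R →+* ℝ}

lemma const (a : α) : SignDetermined ev fun _ : Ω => a :=
  ⟨Empty, inferInstance, Empty.elim, fun _ => a, fun _ => rfl⟩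

lemma sign (f : R) : SignDetermined ev fun ω => SignType.sign (ev ω f) :=
  ⟨Unit, inferInstance, fun _ => f, fun s => s (), fun _ => rfl⟩

lemma map {G : Ω → α} (hG : SignDetermined ev G) (φ : α → β) :
    SignDetermined ev fun ω => φ (G ω) := by
  obtain ⟨κ, hκ, F, Φ, h⟩ := hG
  exact ⟨κ, hκ, F, φ ∘ Φ, fun ω => by simp [h]⟩

lemma pi {ι : Type} [Finite ι] {A : ι → Type*} {G : ∀ i, Ω → A i}
    (hG : ∀ i, SignDetermined ev (G i)) : SignDetermined ev fun ω i => G i ω := by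
  choose κ hκ F Φ h using hG
  exact ⟨Σ i, κ i, inferInstance, fun k => F k.1 k.2, fun s i => Φ i fun k => s ⟨i, k⟩,
    fun ω => by ext i; simp [h]⟩

lemma map₂ {G : Ω → α} {H : Ω → β} (hG : SignDetermined ev G) (hH : SignDetermined ev H)
    (φ : α → β → γ) : SignDetermined ev fun ω => φ (G ω) (H ω) := by
  obtain ⟨κ, hκ, F, Φ, h⟩ := hG
  obtain ⟨κ', hκ', F', Φ', h'⟩ := hH
  exact ⟨κ ⊕ κ', inferInstance, Sum.elim F F',
    fun s => φ (Φ fun k => s (Sum.inl k)) (Φ' fun k => s (Sum.inr k)), fun ω => by simp [h, h']⟩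

open Classical in
lemma ite {p : Ω → Prop} {G H : Ω → α} (hp : SignDetermined ev p) (hG : SignDetermined ev G)
    (hH : SignDetermined ev H) : SignDetermined ev fun ω => if p ω then G ω else H ω :=
  (hp.map₂ (hG.map₂ hH Prod.mk) fun p x => if p then x.1 else x.2)

lemma congr {G H : Ω → α} (hG : SignDetermined ev G) (h : ∀ ω, G ω = H ω) :
    SignDetermined ev H := (funext h : G = H) ▸ hG

lemma eq_zero (f : R) : SignDetermined ev fun ω => ev ω f = 0 :=
  ((sign f).map (· = 0)).congr fun ω => by simp [sign_eq_zero_iff]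

lemma pos (f : R) : SignDetermined ev fun ω => 0 < ev ω f :=
  ((sign f).map (· = 1)).congr fun ω => by simp [sign_eq_one_iff]

lemma not {p : Ω → Prop} (hp : SignDetermined ev p) : SignDetermined ev fun ω => ¬ p ω :=
  hp.map Not

lemma and {p q : Ω → Prop} (hp : SignDetermined ev p) (hq : SignDetermined ev q) :
    SignDetermined ev fun ω => p ω ∧ q ω := hp.map₂ hq And

lemma or {p q : Ω → Prop} (hp : SignDetermined ev p) (hq : SignDetermined ev q) :
    SignDetermined ev fun ω => p ω ∨ q ω := hp.map₂ hq Or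

lemma imp {p q : Ω → Prop} (hp : SignDetermined ev p) (hq : SignDetermined ev q) :
    SignDetermined ev fun ω => p ω → q ω := hp.map₂ hq fun a b => a → b

lemma forall_finite {ι : Type} [Finite ι] {p : ι → Ω → Prop} (hp : ∀ i, SignDetermined ev (p i)) :
    SignDetermined ev fun ω => ∀ i, p i ω := (pi hp).map fun f => ∀ i, f i

lemma exists_finite {ι : Type} [Finite ι] {p : ι → Ω → Prop} (hp : ∀ i, SignDetermined ev (p i)) :
    SignDetermined ev fun ω => ∃ i, p i ω := (pi hp).map fun f => ∃ i, f i

lemma map_eq_zero (f : R[X]) : SignDetermined ev fun ω => f.map (ev ω) = 0 :=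
  (forall_finite fun i : Fin (f.natDegree + 1) => eq_zero (f.coeff i)).congr fun ω => by
    rw [eq_iff_iff]
    refine ⟨fun h => ?_, fun h i => by simpa using congrArg (fun g => g.coeff i) h⟩
    ext i
    by_cases hi : i < f.natDegree + 1
    · simpa using h ⟨i, hi⟩
    · simp [coeff_eq_zero_of_natDegree_lt (show f.natDegree < i by omega)]

lemma map_eraseLead_of_eq_zero {S : Type*} [CommRing S] (φ : R →+* S) {f : R[X]}
    (h : φ f.leadingCoeff = 0) : f.eraseLead.map φ = f.map φ := by
  conv_rhs => rw [← eraseLead_add_C_mul_X_pow f]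
  rw [Polynomial.map_add, Polynomial.map_mul, map_C, h, C_0, zero_mul, add_zero]

lemma sign_leadingCoeff (f : R[X]) :
    SignDetermined ev fun ω => SignType.sign (f.map (ev ω)).leadingCoeff := by
  classical
  induction hn : f.support.card using Nat.strong_induction_on generalizing f with
  | _ n ih =>
  by_cases hf : f = 0
  · simpa [hf] using const 0
  · refine ((eq_zero f.leadingCoeff).ite (ih _ (hn ▸ eraseLead_support_card_lt hf) _ rfl)
      (sign f.leadingCoeff)).congr fun ω => ?_
    split_ifs with h
    · rw [map_eraseLead_of_eq_zero _ h]
    · rw [leadingCoeff_map_of_leadingCoeff_ne_zero _ h]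

lemma degree_cancel_leads_lt {f p : R[X]} (hd : p.natDegree ≤ f.natDegree) :
    (C (p.leadingCoeff ^ 2) * f - C (p.leadingCoeff * f.leadingCoeff) *
      X ^ (f.natDegree - p.natDegree) * p).degree <
    (f.natDegree : WithBot ℕ) := by
  rw [degree_lt_iff_coeff_zero]
  intro m hm
  have e : m = (m - (f.natDegree - p.natDegree)) + (f.natDegree - p.natDegree) := by omega
  rw [coeff_sub, coeff_C_mul, mul_assoc, coeff_C_mul, mul_comm (X ^ _) p]
  conv_lhs => rw [e]
  rw [coeff_mul_X_pow, ← e]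
  rcases hm.eq_or_lt with rfl | hm
  · rw [show f.natDegree - (f.natDegree - p.natDegree) = p.natDegree by omega]
    simp only [coeff_natDegree]
    ring
  · rw [coeff_eq_zero_of_natDegree_lt hm, coeff_eq_zero_of_natDegree_lt (p := p) (by omega)]
    simp

lemma cauchyIndex_cancel_leads (φ : R →+* ℝ) (f p : R[X]) (h : φ p.leadingCoeff ≠ 0) (a : R)
    (q : R[X]) :
    cauchyIndex ((C (p.leadingCoeff ^ 2) * f - C a * q * p).map φ) (p.map φ) =
      cauchyIndex (f.map φ) (p.map φ) := by
  have e : (C (p.leadingCoeff ^ 2) * f - C a * q * p).map φ =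
      C (φ p.leadingCoeff ^ 2) * f.map φ + (-(C (φ a) * q.map φ)) * p.map φ := by
    simp; ring
  rw [e, cauchyIndex_add_mul, cauchyIndex_C_mul _ _ (by positivity)]

lemma cauchyIndex_map_aux (N : ℕ) : ∀ (a b : ℕ), a + b = N → ∀ f p : R[X], f.degree < a →
    p.degree < b → SignDetermined ev fun ω => cauchyIndex (f.map (ev ω)) (p.map (ev ω)) := by
  classical
  induction N using Nat.strong_induction_on with
  | _ N ih =>
  intro a b hab f p hfa hpb
  by_cases hf : f = 0
  · simpa [hf, cauchyIndex_zero_left] using const 0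
  by_cases hp : p = 0
  · simpa [hp, cauchyIndex_zero_right] using const 0
  have hfd := degree_eq_natDegree hf
  have hpd := degree_eq_natDegree hp
  have hfa' : f.natDegree < a := by rw [hfd] at hfa; exact_mod_cast hfa
  have hpb' : p.natDegree < b := by rw [hpd] at hpb; exact_mod_cast hpb
  have h1 := ih (f.natDegree + b) (by omega) _ _ rfl f.eraseLead p
    (hfd ▸ degree_eraseLead_lt hf) hpb
  have h2 := ih (a + p.natDegree) (by omega) _ _ rfl f p.eraseLead hfa
    (hpd ▸ degree_eraseLead_lt hp)
  rcases le_or_gt p.natDegree f.natDegree with hd | hd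
  · have h3 := ih (f.natDegree + b) (by omega) _ _ rfl _ p (degree_cancel_leads_lt hd) hpb
    refine ((eq_zero p.leadingCoeff).ite h2 h3).congr fun ω => ?_
    split_ifs with h
    · rw [map_eraseLead_of_eq_zero _ h]
    · rw [cauchyIndex_cancel_leads _ _ _ h]
  · have h3 := ih (p.natDegree + a) (by omega) _ _ rfl _ f (degree_cancel_leads_lt hd.le) hfa
    have h4 : SignDetermined ev fun ω => if Odd (f.natDegree + p.natDegree) then
        (SignType.sign (ev ω f.leadingCoeff) * SignType.sign (ev ω p.leadingCoeff) : ℤ) else 0 :=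
      ((sign f.leadingCoeff).map₂ (sign p.leadingCoeff) fun s t =>
        if Odd (f.natDegree + p.natDegree) then (s * t : ℤ) else 0)
    refine ((eq_zero p.leadingCoeff).ite h2 ((eq_zero f.leadingCoeff).ite h1
      (h4.map₂ h3 fun s t => s - t))).congr fun ω => ?_
    split_ifs with hpl hfl
    · rw [map_eraseLead_of_eq_zero _ hpl]
    · rw [map_eraseLead_of_eq_zero _ hfl]
    all_goals
      rename_i hodd
      have hf0 : f.map (ev ω) ≠ 0 := fun h => hfl (by
        simpa using congrArg (fun g => g.coeff f.natDegree) h)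
      have hp0 : p.map (ev ω) ≠ 0 := fun h => hpl (by
        simpa using congrArg (fun g => g.coeff p.natDegree) h)
      have key := cauchyIndex_add_swap _ _ hf0 hp0
      rw [sum_signJump, natDegree_mul hf0 hp0, natDegree_map_of_leadingCoeff_ne_zero _ hfl,
        natDegree_map_of_leadingCoeff_ne_zero _ hpl, leadingCoeff_mul,
        leadingCoeff_map_of_leadingCoeff_ne_zero _ hfl,
        leadingCoeff_map_of_leadingCoeff_ne_zero _ hpl] at key
      rw [cauchyIndex_cancel_leads _ _ _ hfl, eq_comm, ← sub_eq_zero]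
      simp only [hodd, if_true, if_false, sign_mul, SignType.coe_mul] at key
      linarith

lemma cauchyIndex_map (f p : R[X]) :
    SignDetermined ev fun ω => cauchyIndex (f.map (ev ω)) (p.map (ev ω)) :=
  cauchyIndex_map_aux _ (f.natDegree + 1) (p.natDegree + 1) rfl f p
    (degree_le_natDegree.trans_lt (by exact_mod_cast Nat.lt_succ_self _))
    (degree_le_natDegree.trans_lt (by exact_mod_cast Nat.lt_succ_self _))

open Classical in
lemma sum_roots (p : R[X]) (L : List R[X]) (g : R[X]) :
    SignDetermined ev fun ω => ∑ x ∈ (p.map (ev ω)).roots.toFinset,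
      if ∀ q ∈ L, 0 < eval x (q.map (ev ω)) then
        (SignType.sign (eval x (g.map (ev ω))) : ℤ) else 0 := by
  induction L generalizing g with
  | nil =>
    refine (cauchyIndex_map (derivative p * g) p).congr fun ω => ?_
    simp [Polynomial.map_mul, ← derivative_map, cauchyIndex_derivative_mul]
  | cons q L ih =>
    refine ((ih (g * q)).map₂ (ih (g * q ^ 2)) fun a b => (a + b) / 2).congr fun ω => ?_
    rw [← Finset.sum_add_distrib]
    refine Int.ediv_eq_of_eq_mul_right two_ne_zero ?_
    rw [Finset.mul_sum]
    refine Finset.sum_congr rfl fun x _ => ?_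
    simp only [List.forall_mem_cons]
    by_cases hL : ∀ q ∈ L, 0 < eval x (q.map (ev ω))
    · rcases lt_trichotomy (eval x (q.map (ev ω))) 0 with h | h | h
      · rw [if_pos hL, if_pos hL, if_neg fun h' => h.not_gt h'.1]
        simp [sign_mul, sign_pow, sign_neg h]
      · rw [if_pos hL, if_pos hL, if_neg fun h' => h'.1.ne' h]
        simp [h]
      · rw [if_pos hL, if_pos hL, if_pos ⟨h, hL⟩]
        simp [sign_mul, sign_pow, sign_pos h, two_mul]
    · rw [if_neg hL, if_neg hL, if_neg fun h' => hL h'.2]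
      simp

lemma exists_root (p : R[X]) (L : List R[X]) :
    SignDetermined ev fun ω => p.map (ev ω) ≠ 0 ∧
      ∃ x, eval x (p.map (ev ω)) = 0 ∧ ∀ q ∈ L, 0 < eval x (q.map (ev ω)) := by
  classical
  refine ((sum_roots p L 1).map fun k => 0 < k).congr fun ω => ?_
  rw [eq_iff_iff]
  simp only [Polynomial.map_one, eval_one, sign_one, SignType.coe_one]
  rw [Finset.sum_ite, Finset.sum_const_zero, add_zero, Finset.sum_const, nsmul_one]
  rw [Nat.cast_pos, Finset.card_pos]
  constructor
  · rintro ⟨x, hx⟩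
    simp only [Finset.mem_filter, Multiset.mem_toFinset, mem_roots'] at hx
    exact ⟨hx.1.1, x, hx.1.2, hx.2⟩
  · rintro ⟨h0, x, hx, hL⟩
    refine ⟨x, ?_⟩
    simp only [Finset.mem_filter, Multiset.mem_toFinset, mem_roots']
    exact ⟨⟨h0, hx⟩, hL⟩

end SignDetermined

lemma eventually_eval_pos {q : ℝ[X]} (hq : 0 < q.leadingCoeff) :
    ∀ᶠ x in atTop, 0 < eval x q := by
  by_cases hd : 0 < q.degree
  · exact (q.tendsto_atTop_of_leadingCoeff_nonneg hd hq.le).eventually_gt_atTop 0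
  · rw [eq_C_of_degree_le_zero (not_lt.1 hd)] at hq ⊢
    rw [leadingCoeff_C] at hq
    exact Eventually.of_forall fun x => by rwa [eval_C]

lemma leadingCoeff_pos_of_forall_not_root {q : ℝ[X]} {a : ℝ} (ha : 0 < eval a q)
    (h : ∀ x, a ≤ x → eval x q ≠ 0) : 0 < q.leadingCoeff := by
  have := sign_eval_of_forall_not_root h
  rwa [sign_pos ha, eq_comm, sign_eq_one_iff] at this

lemma exists_forall_eval_pos_iff (L : List ℝ[X]) :
    (∃ x, ∀ q ∈ L, 0 < eval x q) ↔ (∀ q ∈ L, 0 < q.leadingCoeff) ∨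
      (∀ q ∈ L, 0 < (q.comp (-X)).leadingCoeff) ∨
      (derivative L.prod ≠ 0 ∧ ∃ x, eval x (derivative L.prod) = 0 ∧ ∀ q ∈ L, 0 < eval x q) := by
  have hroot : ∀ q ∈ L, ∀ x, eval x q = 0 → eval x L.prod = 0 := fun q hq x hx =>
    eval_eq_zero_of_dvd_of_eval_eq_zero (List.dvd_prod hq) hx
  constructor
  · rintro ⟨x₀, hx₀⟩
    have hg0 : eval x₀ L.prod ≠ 0 := by
      rw [eval_list_prod]
      simp only [ne_eq, List.prod_eq_zero_iff, List.mem_map, not_exists, not_and]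
      exact fun q hq => (hx₀ q hq).ne'
    have hg : L.prod ≠ 0 := fun h => hg0 (by simp [h])
    by_cases hr : ∃ x, x₀ ≤ x ∧ eval x L.prod = 0
    swap
    · push Not at hr
      exact Or.inl fun q hq => leadingCoeff_pos_of_forall_not_root (hx₀ q hq)
        fun x hx h => hr x hx (hroot q hq x h)
    by_cases hl : ∃ x, x ≤ x₀ ∧ eval x L.prod = 0
    swap
    · push Not at hl
      refine Or.inr (Or.inl fun q hq => leadingCoeff_pos_of_forall_not_root (a := -x₀)
        (by simpa using hx₀ q hq) fun x hx h => hl (-x) (by linarith) (hroot q hq _ ?_))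
      simpa using h
    refine Or.inr (Or.inr ?_)
    obtain ⟨a, ha, hamax⟩ := Finset.exists_max_image
      (L.prod.roots.toFinset.filter (· ≤ x₀)) id
      (hl.imp fun x hx => by simp [hg, hx.1, hx.2])
    obtain ⟨b, hb, hbmin⟩ := Finset.exists_min_image
      (L.prod.roots.toFinset.filter (x₀ ≤ ·)) id
      (hr.imp fun x hx => by simp [hg, hx.1, hx.2])
    simp only [Finset.mem_filter, Multiset.mem_toFinset, mem_roots hg, IsRoot.def, id, and_imp]
      at ha hamax hb hbmin
    have ha' : a < x₀ := lt_of_le_of_ne ha.2 fun h => hg0 (h ▸ ha.1)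
    have hb' : x₀ < b := lt_of_le_of_ne hb.2 fun h => hg0 (h ▸ hb.1)
    obtain ⟨c, hc, hc0⟩ := exists_deriv_eq_zero (ha'.trans hb')
      (L.prod.continuous.continuousOn) (ha.1.trans hb.1.symm)
    rw [Polynomial.deriv] at hc0
    refine ⟨fun h => hg0 ?_, c, hc0, fun q hq => ?_⟩
    · rw [eq_C_of_derivative_eq_zero h] at ha ⊢
      simpa using ha.1
    · by_contra hneg
      obtain ⟨z, hz, hz0⟩ := intermediate_value_uIcc (a := c) (b := x₀) (f := fun x => eval x q)
        q.continuous.continuousOn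
        (show (0 : ℝ) ∈ uIcc _ _ from Set.Icc_subset_uIcc ⟨not_lt.1 hneg, (hx₀ q hq).le⟩)
      have hz0 := hroot q hq z hz0
      have hzI : z ∈ Ioo a b := (ordConnected_Ioo.uIcc_subset hc ⟨ha', hb'⟩) hz
      rcases le_total z x₀ with h | h
      · exact (hamax z hz0 h).not_gt hzI.1
      · exact (hbmin z hz0 h).not_gt hzI.2
  · rintro (h | h | ⟨-, x, -, h⟩)
    · have : ∀ᶠ x in atTop, ∀ q ∈ L.toFinset, 0 < eval x q :=
        (Finset.eventually_all _).2 fun q hq => eventually_eval_pos (h q (by simpa using hq))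
      simpa using this.exists
    · have : ∀ᶠ x in atTop, ∀ q ∈ L.toFinset, 0 < eval x (q.comp (-X)) :=
        (Finset.eventually_all _).2 fun q hq => eventually_eval_pos (h q (by simpa using hq))
      obtain ⟨x, hx⟩ := this.exists
      exact ⟨-x, fun q hq => by simpa using hx q (by simpa using hq)⟩
    · exact ⟨x, h⟩

/-- The action of `R[X]` as functions on `Ω × ℝ` induced by an action of `R` on `Ω`. -/
noncomputable def polynomialEv (ev : Ω → R →+* ℝ) (ω : Ω × ℝ) : R[X] →+* ℝ :=
  eval₂RingHom (ev ω.1) ω.2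

/-- The action of multivariate polynomials over `R` as functions on `Ω × ℝⁿ` induced by an action
of `R` on `Ω`. -/
noncomputable def mvPolynomialEv (n : ℕ) (ev : Ω → R →+* ℝ) (ω : Ω × (Fin n → ℝ)) :
    MvPolynomial (Fin n) R →+* ℝ :=
  MvPolynomial.eval₂Hom (ev ω.1) ω.2

namespace SignDetermined

variable {ev : Ω → R →+* ℝ}

lemma forall_mem_list {ι : Type*} (L : List ι) {p : ι → Ω → Prop}
    (hp : ∀ i, SignDetermined ev (p i)) : SignDetermined ev fun ω => ∀ i ∈ L, p i ω :=
  (forall_finite fun i : Fin L.length => hp (L.get i)).congr fun ω => by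
    simp [List.forall_mem_iff_getElem, Fin.forall_iff]

lemma exists_pos (L : List R[X]) :
    SignDetermined ev fun ω => ∃ x, ∀ q ∈ L, 0 < eval x (q.map (ev ω)) := by
  have hlc : ∀ q : R[X], SignDetermined ev fun ω => 0 < (q.map (ev ω)).leadingCoeff := fun q =>
    ((sign_leadingCoeff q).map (· = 1)).congr fun ω => by simp [sign_eq_one_iff]
  refine ((forall_mem_list L hlc).or ((forall_mem_list L fun q => hlc (q.comp (-X))).or
    (exists_root (derivative L.prod) L))).congr fun ω => ?_
  have hprod : (L.map (Polynomial.map (ev ω))).prod = L.prod.map (ev ω) :=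
    (map_list_prod (mapRingHom (ev ω)) L).symm
  have := exists_forall_eval_pos_iff (L.map (Polynomial.map (ev ω)))
  rw [hprod] at this
  simp only [List.forall_mem_map, derivative_map] at this
  rw [eq_iff_iff, this]
  simp only [Polynomial.map_comp, Polynomial.map_neg, map_X]

lemma exists_sign_eq {κ : Type} [Finite κ] (F : κ → R[X]) (σ : κ → SignType) :
    SignDetermined ev fun ω => ∃ x, ∀ k, SignType.sign (eval x ((F k).map (ev ω))) = σ k := by
  classical
  have := Fintype.ofFinite κ
  set p : R[X] := ∑ k with σ k = 0, F k ^ 2 with hp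
  set L : List R[X] := (Finset.univ.filter fun k => σ k ≠ 0).toList.map
    fun k => if σ k = 1 then F k else -F k with hL
  refine ((exists_root p L).or ((map_eq_zero p).and (exists_pos L))).congr fun ω => ?_
  have hiff : ∀ x, (∀ k, SignType.sign (eval x ((F k).map (ev ω))) = σ k) ↔
      eval x (p.map (ev ω)) = 0 ∧ ∀ q ∈ L, 0 < eval x (q.map (ev ω)) := by
    intro x
    have h1 : eval x (p.map (ev ω)) = 0 ↔ ∀ k, σ k = 0 → eval x ((F k).map (ev ω)) = 0 := by
      rw [hp, Polynomial.map_sum, eval_finsetSum, Finset.sum_eq_zero_iff_of_nonneg]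
      · simp
      · intro k _
        simp [sq_nonneg]
    have h2 : (∀ q ∈ L, 0 < eval x (q.map (ev ω))) ↔
        ∀ k, σ k ≠ 0 → SignType.sign (eval x ((F k).map (ev ω))) = σ k := by
      simp only [hL, List.forall_mem_map, Finset.mem_toList, Finset.mem_filter, Finset.mem_univ,
        true_and]
      refine forall_congr' fun k => imp_congr_right fun hk => ?_
      rcases h : σ k
      · exact absurd h hk
      · simp [sign_eq_neg_one_iff]
      · simp [sign_eq_one_iff]
    rw [h1, h2]
    constructor
    · exact fun h => ⟨fun k hk => by rw [← sign_eq_zero_iff, h, hk], fun k _ => h k⟩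
    · rintro ⟨ha, hb⟩ k
      by_cases hk : σ k = 0
      · rw [ha k hk, hk, sign_zero]
      · exact hb k hk
  rw [eq_iff_iff]
  simp only [hiff]
  by_cases h0 : p.map (ev ω) = 0 <;> simp [h0]

/-- Quantifier elimination for one real variable. -/
lemma exists_real {G : Ω × ℝ → Prop} (hG : SignDetermined (polynomialEv ev) G) :
    SignDetermined ev fun ω => ∃ x, G (ω, x) := by
  obtain ⟨κ, hκ, F, Φ, h⟩ := hG
  refine ((pi fun σ : κ → SignType => exists_sign_eq F σ).map
    fun g => ∃ σ, Φ σ ∧ g σ).congr fun ω => ?_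
  rw [eq_iff_iff]
  simp only [h]
  constructor
  · rintro ⟨σ, hσ, x, hx⟩
    refine ⟨x, ?_⟩
    convert hσ with k
    rw [← hx k, eval_map]
    rfl
  · rintro ⟨x, hx⟩
    refine ⟨_, hx, x, fun k => ?_⟩
    rw [eval_map]
    rfl

lemma mvPolynomialEv_cons {n : ℕ} (ω : Ω) (x : ℝ) (y : Fin n → ℝ)
    (f : MvPolynomial (Fin (n + 1)) R) :
    mvPolynomialEv (n + 1) ev (ω, Fin.cons x y) f =
      polynomialEv (mvPolynomialEv n ev) ((ω, y), x) (MvPolynomial.finSuccEquiv R n f) := by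
  induction f using MvPolynomial.induction_on with
  | C a => simp [mvPolynomialEv, polynomialEv, MvPolynomial.finSuccEquiv_apply]
  | add p q hp hq => simp [hp, hq]
  | mul_X p i hp =>
    rw [map_mul, map_mul, map_mul, hp]
    congr 1
    refine Fin.cases ?_ (fun j => ?_) i
    · simp [mvPolynomialEv, polynomialEv, MvPolynomial.finSuccEquiv_X_zero]
    · simp [mvPolynomialEv, polynomialEv, MvPolynomial.finSuccEquiv_X_succ]

/-- Quantifier elimination for finitely many real variables. -/
lemma exists_vec {n : ℕ} {G : Ω × (Fin n → ℝ) → Prop}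
    (hG : SignDetermined (mvPolynomialEv n ev) G) :
    SignDetermined ev fun ω => ∃ y, G (ω, y) := by
  induction n with
  | zero =>
    obtain ⟨κ, hκ, F, Φ, h⟩ := hG
    choose f hf using fun k => MvPolynomial.C_surjective (Fin 0) (F k)
    refine ⟨κ, hκ, f, Φ, fun ω => ?_⟩
    simp [Unique.exists_iff, h, ← hf, mvPolynomialEv]
  | succ n ih =>
    have h1 : SignDetermined (polynomialEv (mvPolynomialEv n ev))
        fun ω => G (ω.1.1, Fin.cons ω.2 ω.1.2) := by
      obtain ⟨κ, hκ, F, Φ, h⟩ := hG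
      refine ⟨κ, hκ, fun k => MvPolynomial.finSuccEquiv R n (F k), Φ, fun ω => ?_⟩
      simp only [h, mvPolynomialEv_cons]
    refine (ih h1.exists_real).congr fun ω => ?_
    rw [eq_iff_iff]
    constructor
    · rintro ⟨y, x, h⟩
      exact ⟨_, h⟩
    · rintro ⟨y, h⟩
      exact ⟨Fin.tail y, y 0, by simpa using h⟩

end SignDetermined

end QuantifierElimination

section Germ

open Polynomial Topology

/-- `ℝ[X][X]` acting as polynomial functions of `(r, t)`. -/
noncomputable def bivariateEv : ℝ × ℝ → ℝ[X][X] →+* ℝ :=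
  polynomialEv fun r => evalRingHom r

lemma continuous_bivariateEv (P : ℝ[X][X]) : Continuous fun ω => bivariateEv ω P := by
  simp only [bivariateEv, polynomialEv, coe_eval₂RingHom, eval₂_eq_sum_range, coe_evalRingHom]
  fun_prop

lemma sign_eq_of_abs_sub_lt {a b : ℝ} (h : |a - b| < |b|) :
    SignType.sign a = SignType.sign b := by
  rcases lt_trichotomy b 0 with hb | hb | hb
  · rw [abs_of_neg hb] at h
    rw [sign_neg hb, sign_neg (by linarith [(abs_lt.1 h).2])]
  · simp [hb] at h
    exact absurd h (abs_nonneg a).not_gt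
  · rw [abs_of_pos hb] at h
    rw [sign_pos hb, sign_pos (by linarith [(abs_lt.1 h).1])]

lemma eventually_sign_bivariateEv_eq (P : ℝ[X][X]) :
    ∃ σ, ∀ᶠ M : ℕ in atTop, ∀ᶠ r : ℝ in 𝓝[>] 0, ∀ t, 0 < t → t ≤ r ^ M →
      SignType.sign (bivariateEv (r, t) P) = σ := by
  induction P using Polynomial.recOnHorner with
  | M0 => exact ⟨0, by simp⟩
  | MX p hp ih =>
    obtain ⟨σ, hσ⟩ := ih
    refine ⟨σ, hσ.mono fun M hM => hM.mono fun r hr t ht htM => ?_⟩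
    rw [map_mul, sign_mul, hr t ht htM]
    simp [bivariateEv, polynomialEv, sign_pos ht]
  | MC p a hp0 ha _ =>
    obtain ⟨b, g, rfl, hg⟩ := exists_eq_X_sub_C_pow_mul ha 0
    obtain ⟨K, hK⟩ := (isCompact_Icc (a := (0 : ℝ)) (b := 1)).prod
      (isCompact_Icc (a := (0 : ℝ)) (b := 1)) |>.exists_bound_of_continuousOn
      (continuous_bivariateEv p.divX).continuousOn
    refine ⟨SignType.sign (eval 0 g), ?_⟩
    filter_upwards [eventually_ge_atTop (b + 1)] with M hM
    have hlim : Tendsto (fun r : ℝ => |eval r g - eval 0 g| + r * K) (𝓝[>] 0) (𝓝 0) := by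
      have : Continuous fun r : ℝ => |eval r g - eval 0 g| + r * K := by fun_prop
      simpa using (this.tendsto 0).mono_left nhdsWithin_le_nhds
    filter_upwards [hlim.eventually (gt_mem_nhds (abs_pos.2 hg)), self_mem_nhdsWithin,
      mem_nhdsWithin_of_mem_nhds (Iio_mem_nhds (zero_lt_one (α := ℝ)))] with r hr hr0 hr1 t ht htM
    have hr0 : 0 < r := hr0
    have hr1 : r < 1 := hr1
    have htr : t ≤ r * r ^ b := by
      rw [← pow_succ']
      exact htM.trans (pow_le_pow_of_le_one hr0.le hr1.le hM)
    have ht1 : t ≤ 1 := htr.trans (by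
      nlinarith [pow_le_one₀ hr0.le hr1.le (n := b), pow_pos hr0 b])
    have hQ : |bivariateEv (r, t) p.divX| ≤ K := hK (r, t) ⟨⟨hr0.le, hr1.le⟩, ht.le, ht1⟩
    have hv : bivariateEv (r, t) (p + C ((X - C 0) ^ b * g)) =
        r ^ b * (eval r g + t / r ^ b * bivariateEv (r, t) p.divX) := by
      conv_lhs => rw [← divX_mul_X_add p, hp0]
      have : r ^ b ≠ 0 := by positivity
      simp [bivariateEv, polynomialEv, Polynomial.eval₂_pow]
      field_simp
      ring
    rw [hv, sign_mul, sign_pos (by positivity : (0 : ℝ) < r ^ b), one_mul]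
    refine sign_eq_of_abs_sub_lt (lt_of_le_of_lt ?_ hr)
    have hw : |t / r ^ b * bivariateEv (r, t) p.divX| ≤ r * K := by
      rw [abs_mul, abs_of_nonneg (by positivity)]
      exact mul_le_mul (by rwa [div_le_iff₀ (by positivity)]) hQ (abs_nonneg _) hr0.le
    calc |eval r g + t / r ^ b * bivariateEv (r, t) p.divX - eval 0 g|
        = |(eval r g - eval 0 g) + t / r ^ b * bivariateEv (r, t) p.divX| := by ring_nf
      _ ≤ _ := (abs_add_le _ _).trans (by gcongr)

/-- A semialgebraic condition on `(r, t)` is constant on `0 < t ≤ r ^ M` for small `r`. -/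
lemma SignDetermined.eventually_const {T : ℝ × ℝ → Prop} (hT : SignDetermined bivariateEv T) :
    ∃ τ : Prop, ∀ᶠ M : ℕ in atTop, ∀ᶠ r : ℝ in 𝓝[>] 0, ∀ t, 0 < t → t ≤ r ^ M →
      (T (r, t) ↔ τ) := by
  obtain ⟨κ, hκ, F, Φ, h⟩ := hT
  choose σ hσ using fun k => eventually_sign_bivariateEv_eq (F k)
  refine ⟨Φ σ, (eventually_all.2 hσ).mono fun M hM => (eventually_all.2 hM).mono
    fun r hr t ht htM => ?_⟩
  rw [h, show (fun k => SignType.sign (bivariateEv (r, t) (F k))) = σ from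
    funext fun k => hr k t ht htM]

end Germ

section PolynomialFunctions

variable {Ω R : Type*} [CommRing R]

/-- `g` is one of the functions on `Ω` given by the elements of `R`. -/
def IsPolyFun (ev : Ω → R →+* ℝ) (g : Ω → ℝ) : Prop := ∃ f : R, ∀ ω, ev ω f = g ω

namespace IsPolyFun

variable {ev : Ω → R →+* ℝ} {g h : Ω → ℝ}

lemma add (hg : IsPolyFun ev g) (hh : IsPolyFun ev h) : IsPolyFun ev fun ω => g ω + h ω := by
  obtain ⟨f, hf⟩ := hg
  obtain ⟨f', hf'⟩ := hh
  exact ⟨f + f', fun ω => by simp [hf, hf']⟩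

lemma mul (hg : IsPolyFun ev g) (hh : IsPolyFun ev h) : IsPolyFun ev fun ω => g ω * h ω := by
  obtain ⟨f, hf⟩ := hg
  obtain ⟨f', hf'⟩ := hh
  exact ⟨f * f', fun ω => by simp [hf, hf']⟩

lemma neg (hg : IsPolyFun ev g) : IsPolyFun ev fun ω => -g ω := by
  obtain ⟨f, hf⟩ := hg
  exact ⟨-f, fun ω => by simp [hf]⟩

lemma sub (hg : IsPolyFun ev g) (hh : IsPolyFun ev h) : IsPolyFun ev fun ω => g ω - h ω := by
  simpa only [sub_eq_add_neg] using hg.add hh.neg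

lemma pow (hg : IsPolyFun ev g) (k : ℕ) : IsPolyFun ev fun ω => g ω ^ k := by
  obtain ⟨f, hf⟩ := hg
  exact ⟨f ^ k, fun ω => by simp [hf]⟩

lemma sum {ι : Type*} (s : Finset ι) {g : ι → Ω → ℝ} (hg : ∀ i, IsPolyFun ev (g i)) :
    IsPolyFun ev fun ω => ∑ i ∈ s, g i ω := by
  choose f hf using hg
  exact ⟨∑ i ∈ s, f i, fun ω => by simp [hf]⟩

lemma fst {n : ℕ} (hg : IsPolyFun ev g) :
    IsPolyFun (mvPolynomialEv n ev) fun ω => g ω.1 := by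
  obtain ⟨f, hf⟩ := hg
  exact ⟨MvPolynomial.C f, fun ω => by simp [mvPolynomialEv, hf]⟩

lemma coord {n : ℕ} (i : Fin n) :
    IsPolyFun (mvPolynomialEv n ev) fun ω => ω.2 i :=
  ⟨MvPolynomial.X i, fun ω => by simp [mvPolynomialEv]⟩

lemma mvPolynomial_eval {n : ℕ} (hc : ∀ c : ℝ, IsPolyFun ev fun _ => c) {y : Ω → Fin n → ℝ}
    (hy : ∀ i, IsPolyFun ev fun ω => y ω i) (q : MvPolynomial (Fin n) ℝ) :
    IsPolyFun ev fun ω => MvPolynomial.eval (y ω) q := by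
  induction q using MvPolynomial.induction_on with
  | C a => simpa using hc a
  | add p q hp hq => simpa using hp.add hq
  | mul_X p i hp => simpa using hp.mul (hy i)

lemma pos (hg : IsPolyFun ev g) : SignDetermined ev fun ω => 0 < g ω := by
  obtain ⟨f, hf⟩ := hg
  exact (SignDetermined.pos f).congr fun ω => by rw [hf]

lemma lt (hg : IsPolyFun ev g) (hh : IsPolyFun ev h) : SignDetermined ev fun ω => g ω < h ω :=
  (hh.sub hg).pos.congr fun ω => by simp

lemma le (hg : IsPolyFun ev g) (hh : IsPolyFun ev h) : SignDetermined ev fun ω => g ω ≤ h ω :=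
  (hh.lt hg).not.congr fun ω => by simp

lemma eq (hg : IsPolyFun ev g) (hh : IsPolyFun ev h) : SignDetermined ev fun ω => g ω = h ω :=
  ((hg.le hh).and (hh.le hg)).congr fun ω => by rw [eq_iff_iff, le_antisymm_iff]

end IsPolyFun

lemma isPolyFun_bivariateEv_const (c : ℝ) : IsPolyFun bivariateEv fun _ => c :=
  ⟨Polynomial.C (Polynomial.C c), fun ω => by simp [bivariateEv, polynomialEv]⟩

lemma isPolyFun_bivariateEv_fst : IsPolyFun bivariateEv fun ω => ω.1 :=
  ⟨Polynomial.C Polynomial.X, fun ω => by simp [bivariateEv, polynomialEv]⟩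

lemma isPolyFun_bivariateEv_snd : IsPolyFun bivariateEv fun ω => ω.2 :=
  ⟨Polynomial.X, fun ω => by simp [bivariateEv, polynomialEv]⟩

end PolynomialFunctions

section Lojasiewicz

open Topology

/-- The value of a polynomial at a point of Euclidean space. -/
noncomputable abbrev polyVal {n : ℕ} (p : MvPolynomial (Fin n) ℝ) (x : EuclideanSpace ℝ (Fin n)) : ℝ :=
  MvPolynomial.eval x.ofLp p

variable {n : ℕ}

lemma contDiff_polyVal (p : MvPolynomial (Fin n) ℝ) : ContDiff ℝ 1 (polyVal p) := by
  induction p using MvPolynomial.induction_on with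
  | C a =>
    have : polyVal (.C a : MvPolynomial (Fin n) ℝ) = fun _ => a := by ext; simp
    exact this ▸ contDiff_const
  | add p q hp hq =>
    have : polyVal (p + q) = fun x => polyVal p x + polyVal q x := by ext; simp
    exact this ▸ hp.add hq
  | mul_X p i hp =>
    have : polyVal (p * .X i) = fun x => polyVal p x * x.ofLp i := by ext; simp
    exact this ▸ hp.mul (by fun_prop)

lemma continuous_polyVal (p : MvPolynomial (Fin n) ℝ) : Continuous (polyVal p) :=
  (contDiff_polyVal p).continuous

lemma MvPolynomial.eq_zero_of_eventually_polyVal_eq_zero {p : MvPolynomial (Fin n) ℝ}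
    {x₀ : EuclideanSpace ℝ (Fin n)} (h : ∀ᶠ x in 𝓝 x₀, polyVal p x = 0) : p = 0 := by
  have hc : Tendsto (fun y : Fin n → ℝ => WithLp.toLp 2 y) (𝓝 x₀.ofLp) (𝓝 x₀) :=
    (PiLp.continuous_toLp 2 _).tendsto x₀.ofLp
  obtain ⟨ε, hε, hb⟩ := Metric.eventually_nhds_iff_ball.1 (hc.eventually h)
  refine MvPolynomial.funext_set (fun i => ball (x₀.ofLp i) ε)
    (fun i => ?_) fun y hy => ?_
  · rw [Real.ball_eq_Ioo]
    exact Ioo_infinite (by linarith)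
  · rw [map_zero]
    refine hb y ?_
    rw [mem_ball, dist_pi_lt_iff hε]
    exact fun i => hy i (mem_univ i)

lemma eventually_lt_nhdsGT_zero {δ : ℝ} (hδ : 0 < δ) : ∀ᶠ r : ℝ in 𝓝[>] 0, r < δ :=
  mem_nhdsWithin_of_mem_nhds (Iio_mem_nhds hδ)

section Definability

variable {Ω R : Type*} [CommRing R] {ev : Ω → R →+* ℝ}

lemma SignDetermined.exists_euclidean {G : Ω × EuclideanSpace ℝ (Fin n) → Prop}
    (hG : SignDetermined (mvPolynomialEv n ev) fun ω => G (ω.1, WithLp.toLp 2 ω.2)) :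
    SignDetermined ev fun ω => ∃ x, G (ω, x) :=
  hG.exists_vec.congr fun ω => by
    rw [eq_iff_iff]
    exact ⟨fun ⟨y, hy⟩ => ⟨_, hy⟩, fun ⟨x, hx⟩ => ⟨x.ofLp, hx⟩⟩

lemma SignDetermined.forall_euclidean {G : Ω × EuclideanSpace ℝ (Fin n) → Prop}
    (hG : SignDetermined (mvPolynomialEv n ev) fun ω => G (ω.1, WithLp.toLp 2 ω.2)) :
    SignDetermined ev fun ω => ∀ x, G (ω, x) :=
  (SignDetermined.exists_euclidean (G := fun ω => ¬ G ω) hG.not).not.congr fun ω => by simp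

lemma IsPolyFun.norm_sq {y : Ω → Fin n → ℝ} (hy : ∀ i, IsPolyFun ev fun ω => y ω i) :
    IsPolyFun ev fun ω => ‖WithLp.toLp 2 (y ω)‖ ^ 2 := by
  simp only [EuclideanSpace.real_norm_sq_eq]
  exact IsPolyFun.sum _ fun i => (hy i).pow 2

lemma IsPolyFun.norm_sub_sq {y z : Ω → Fin n → ℝ} (hy : ∀ i, IsPolyFun ev fun ω => y ω i)
    (hz : ∀ i, IsPolyFun ev fun ω => z ω i) :
    IsPolyFun ev fun ω => ‖WithLp.toLp 2 (y ω) - WithLp.toLp 2 (z ω)‖ ^ 2 := by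
  simp only [← WithLp.toLp_sub]
  exact IsPolyFun.norm_sq fun i => (hy i).sub (hz i)

end Definability

/-- A set given by finitely many polynomial inequalities meets all small spheres if it
accumulates at the origin. -/
lemma eventually_exists_norm_eq {ι : Type} [Finite ι] {κ : ι → Type} [∀ j, Finite (κ j)]
    (q : ∀ j, κ j → MvPolynomial (Fin n) ℝ)
    (hacc : ∀ ε > 0, ∃ x : EuclideanSpace ℝ (Fin n), x ≠ 0 ∧ ‖x‖ < ε ∧
      ∃ j, ∀ i, 0 ≤ polyVal (q j i) x) :
    ∀ᶠ r : ℝ in 𝓝[>] 0, ∃ x : EuclideanSpace ℝ (Fin n), ‖x‖ = r ∧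
      ∃ j, ∀ i, 0 ≤ polyVal (q j i) x := by
  have hT : SignDetermined bivariateEv fun ω : ℝ × ℝ => ∃ x : EuclideanSpace ℝ (Fin n),
      ‖x‖ ^ 2 = ω.1 ^ 2 ∧ ∃ j, ∀ i, 0 ≤ polyVal (q j i) x := by
    have hc : ∀ c : ℝ, IsPolyFun (mvPolynomialEv n bivariateEv) fun _ => c :=
      fun c => (isPolyFun_bivariateEv_const c).fst
    refine SignDetermined.exists_euclidean (G := fun ω : (ℝ × ℝ) × EuclideanSpace ℝ (Fin n) =>
      ‖ω.2‖ ^ 2 = ω.1.1 ^ 2 ∧ ∃ j, ∀ i, 0 ≤ polyVal (q j i) ω.2) ?_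
    exact ((IsPolyFun.norm_sq IsPolyFun.coord).eq (isPolyFun_bivariateEv_fst.fst.pow 2)).and
      (SignDetermined.exists_finite fun j => SignDetermined.forall_finite fun i =>
        (hc 0).le (IsPolyFun.mvPolynomial_eval hc IsPolyFun.coord _))
  obtain ⟨τ, hτ⟩ := hT.eventually_const
  obtain ⟨M, hM⟩ := hτ.exists
  have hM' : ∀ᶠ r : ℝ in 𝓝[>] 0, (∃ x : EuclideanSpace ℝ (Fin n), ‖x‖ = r ∧
      ∃ j, ∀ i, 0 ≤ polyVal (q j i) x) ↔ τ := by
    filter_upwards [hM, self_mem_nhdsWithin] with r hr (hr0 : 0 < r)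
    rw [← hr (r ^ M) (by positivity) le_rfl]
    simp only [pow_left_inj₀ (norm_nonneg _) hr0.le two_ne_zero]
  obtain ⟨ε, hε, hsub⟩ := mem_nhdsGT_iff_exists_Ioo_subset.1 hM'
  obtain ⟨x, hx0, hxε, hx⟩ := hacc ε hε
  have : τ := (hsub (show ‖x‖ ∈ Ioo 0 ε from ⟨norm_pos_iff.2 hx0, hxε⟩)).1 ⟨x, rfl, hx⟩
  exact hM'.mono fun r hr => hr.2 this

/-- A point of a small sphere where the inequalities almost hold is close to a point of the same
sphere where they hold. -/
lemma eventually_exists_dist_le_of_almost_nonneg {κ : Type} [Finite κ]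
    (h : κ → MvPolynomial (Fin n) ℝ) (s : ℕ) :
    ∀ᶠ M : ℕ in atTop, ∀ᶠ r : ℝ in 𝓝[>] 0, ∀ x : EuclideanSpace ℝ (Fin n), ‖x‖ = r →
      (∀ i, -r ^ M ≤ polyVal (h i) x) →
        ∃ a : EuclideanSpace ℝ (Fin n), ‖a‖ = r ∧ (∀ i, 0 ≤ polyVal (h i) a) ∧
          dist x a ≤ r ^ s := by
  have hT : SignDetermined bivariateEv fun ω : ℝ × ℝ => ∃ x : EuclideanSpace ℝ (Fin n),
      ‖x‖ ^ 2 = ω.1 ^ 2 ∧ (∀ i, -ω.2 ≤ polyVal (h i) x) ∧ ∀ a : EuclideanSpace ℝ (Fin n),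
        ‖a‖ ^ 2 = ω.1 ^ 2 → (∀ i, 0 ≤ polyVal (h i) a) → (ω.1 ^ s) ^ 2 < ‖x - a‖ ^ 2 := by
    have hc : ∀ c : ℝ, IsPolyFun (mvPolynomialEv n bivariateEv) fun _ => c :=
      fun c => (isPolyFun_bivariateEv_const c).fst
    have hc' : ∀ c : ℝ, IsPolyFun (mvPolynomialEv n (mvPolynomialEv n bivariateEv)) fun _ => c :=
      fun c => (hc c).fst
    have hr := isPolyFun_bivariateEv_fst.fst (n := n)
    refine SignDetermined.exists_euclidean (G := fun ω : (ℝ × ℝ) × EuclideanSpace ℝ (Fin n) =>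
      ‖ω.2‖ ^ 2 = ω.1.1 ^ 2 ∧ (∀ i, -ω.1.2 ≤ polyVal (h i) ω.2) ∧
        ∀ a : EuclideanSpace ℝ (Fin n), ‖a‖ ^ 2 = ω.1.1 ^ 2 → (∀ i, 0 ≤ polyVal (h i) a) →
          (ω.1.1 ^ s) ^ 2 < ‖ω.2 - a‖ ^ 2) ?_
    refine ((IsPolyFun.norm_sq IsPolyFun.coord).eq (hr.pow 2)).and
      ((SignDetermined.forall_finite fun i => isPolyFun_bivariateEv_snd.fst.neg.le
        (IsPolyFun.mvPolynomial_eval hc IsPolyFun.coord _)).and ?_)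
    refine SignDetermined.forall_euclidean
      (G := fun ω : ((ℝ × ℝ) × (Fin n → ℝ)) × EuclideanSpace ℝ (Fin n) =>
        ‖ω.2‖ ^ 2 = ω.1.1.1 ^ 2 → (∀ i, 0 ≤ polyVal (h i) ω.2) →
          (ω.1.1.1 ^ s) ^ 2 < ‖WithLp.toLp 2 ω.1.2 - ω.2‖ ^ 2) ?_
    exact ((IsPolyFun.norm_sq IsPolyFun.coord).eq (hr.fst.pow 2)).imp
      ((SignDetermined.forall_finite fun i => (hc' 0).le
        (IsPolyFun.mvPolynomial_eval hc' IsPolyFun.coord _)).imp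
      (((hr.fst.pow s).pow 2).lt
        (IsPolyFun.norm_sub_sq (fun i => (IsPolyFun.coord i).fst) IsPolyFun.coord)))
  obtain ⟨τ, hτ⟩ := hT.eventually_const
  by_cases hτ' : τ
  · exfalso
    obtain ⟨M, hM⟩ := hτ.exists
    obtain ⟨r, hr, hr0 : 0 < r⟩ := (hM.and self_mem_nhdsWithin).exists
    simp only [hτ', iff_true] at hr
    have ht : ∀ k : ℕ, 0 < r ^ M / (k + 1) ∧ r ^ M / (k + 1) ≤ r ^ M := fun k =>
      ⟨by positivity, div_le_self (by positivity) (by linarith [k.cast_nonneg (α := ℝ)])⟩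
    choose x hx hxh hxa using fun k : ℕ => hr (r ^ M / (k + 1)) (ht k).1 (ht k).2
    have hxs : ∀ k, x k ∈ sphere (0 : EuclideanSpace ℝ (Fin n)) r := fun k => by
      simpa [pow_left_inj₀ (norm_nonneg _) hr0.le two_ne_zero] using hx k
    obtain ⟨y, hy, φ, hφ, hlim⟩ := (isCompact_sphere _ _).tendsto_subseq hxs
    have ht0 : Tendsto (fun k : ℕ => -(r ^ M / ((k : ℝ) + 1))) atTop (𝓝 (-0)) :=
      (tendsto_const_nhds.div_atTop
        (tendsto_atTop_add_const_right _ _ tendsto_natCast_atTop_atTop)).neg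
    have hyh : ∀ i, 0 ≤ polyVal (h i) y := fun i => by
      have := le_of_tendsto_of_tendsto' (ht0.comp hφ.tendsto_atTop)
        (((continuous_polyVal (h i)).tendsto y).comp hlim) fun k => hxh (φ k) i
      simpa using this
    have hyn : ‖y‖ = r := by simpa using hy
    have hd : Tendsto (fun k => ‖x (φ k) - y‖ ^ 2) atTop (𝓝 (‖y - y‖ ^ 2)) :=
      ((hlim.sub_const y).norm).pow 2
    have := ge_of_tendsto' hd fun k => (hxa (φ k) y (by rw [hyn]) hyh).le
    rw [sub_self, norm_zero] at this
    have : 0 < (r ^ s) ^ 2 := by positivity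
    linarith
  · filter_upwards [hτ] with M hM
    filter_upwards [hM, self_mem_nhdsWithin] with r hr (hr0 : 0 < r) x hx hxh
    by_contra! hcon
    refine hτ' ((hr (r ^ M) (by positivity) le_rfl).1 ⟨x, by rw [hx], hxh, fun a ha hah => ?_⟩)
    have := hcon a ((pow_left_inj₀ (norm_nonneg _) hr0.le two_ne_zero).1 ha) hah
    rw [dist_eq_norm] at this
    exact pow_lt_pow_left₀ this (by positivity) two_ne_zero

/-- A polynomial that vanishes on a relatively open nonempty piece of every small sphere is
zero. -/
lemma MvPolynomial.eq_zero_of_vanishes_on_spheres (f : MvPolynomial (Fin n) ℝ)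
    (hf : ∀ᶠ r : ℝ in 𝓝[>] 0, ∃ a : EuclideanSpace ℝ (Fin n), ∃ δ > 0, ‖a‖ = r ∧
      ∀ x : EuclideanSpace ℝ (Fin n), ‖x‖ = r → dist x a < δ → polyVal f x = 0) : f = 0 := by
  obtain ⟨ε, hε, hsub⟩ := mem_nhdsGT_iff_exists_Ioo_subset.1 hf
  have hε : 0 < ε := hε
  set c := TopologicalSpace.denseSeq (EuclideanSpace ℝ (Fin n)) with hc
  let ι := {m : ℕ × ℕ // ∃ u : EuclideanSpace ℝ (Fin n), ‖u‖ = 1 ∧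
    dist u (c m.1) < 1 / ((m.2 : ℝ) + 1)}
  let S : Option ι → Set ℝ := fun m => m.elim (Ioo 0 ε)ᶜ fun m =>
    {r | ∀ u : EuclideanSpace ℝ (Fin n), ‖u‖ = 1 →
      dist u (c m.1.1) ≤ 1 / ((m.1.2 : ℝ) + 1) → polyVal f (r • u) = 0}
  have hS : ∀ m, IsClosed (S m) := by
    rintro (_ | m)
    · exact isOpen_Ioo.isClosed_compl
    · simp only [S, Option.elim_some, ofPred_forall]
      refine isClosed_iInter fun u => isClosed_iInter fun _ => isClosed_iInter fun _ => ?_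
      exact isClosed_eq ((continuous_polyVal f).comp (by fun_prop)) continuous_const
  have hU : ⋃ m, S m = univ := by
    refine eq_univ_of_forall fun r => mem_iUnion.2 ?_
    by_cases hr : r ∈ Ioo 0 ε
    swap
    · exact ⟨none, hr⟩
    obtain ⟨a, δ, hδ, ha, hfa⟩ := hsub hr
    have hr0 : 0 < r := hr.1
    obtain ⟨k, hk⟩ := exists_nat_one_div_lt (show 0 < δ / (2 * r) by positivity)
    have hk0 : (0 : ℝ) < 1 / ((k : ℝ) + 1) := by positivity
    obtain ⟨m, hm⟩ := (TopologicalSpace.denseRange_denseSeq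
      (EuclideanSpace ℝ (Fin n))).exists_dist_lt (r⁻¹ • a) hk0
    refine ⟨some ⟨(m, k), r⁻¹ • a, ?_, hm⟩, fun u hu hud => hfa _ ?_ ?_⟩
    · rw [norm_smul, ha, norm_inv, Real.norm_of_nonneg hr0.le, inv_mul_cancel₀ hr0.ne']
    · rw [norm_smul, hu, Real.norm_of_nonneg hr0.le, mul_one]
    · have h1 : dist u (r⁻¹ • a) < δ / r := by
        have := dist_triangle_right u (r⁻¹ • a) (c m)
        have e : δ / r = δ / (2 * r) + δ / (2 * r) := by field_simp; ring
        have hud : dist u (c m) ≤ 1 / ((k : ℝ) + 1) := hud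
        have hm : dist (r⁻¹ • a) (c m) < 1 / ((k : ℝ) + 1) := hm
        linarith
      have h2 : dist (r • u) a = r * dist u (r⁻¹ • a) := by
        conv_lhs => rw [← smul_inv_smul₀ hr0.ne' a]
        rw [dist_smul₀, Real.norm_of_nonneg hr0.le]
      rw [h2]
      rwa [lt_div_iff₀' hr0] at h1
  obtain ⟨r, hrI, hr⟩ := (dense_iUnion_interior_of_closed hS hU).inter_open_nonempty _
    isOpen_Ioo (nonempty_Ioo.2 hε)
  obtain ⟨m, hm⟩ := mem_iUnion.1 hr
  rcases m with _ | ⟨⟨m, k⟩, u, hu, hud⟩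
  · exact absurd hrI (interior_subset hm)
  have hr0 : 0 < r := hrI.1
  refine MvPolynomial.eq_zero_of_eventually_polyVal_eq_zero (x₀ := r • u) ?_
  have hn : ‖r • u‖ = r := by rw [norm_smul, hu, Real.norm_of_nonneg hr0.le, mul_one]
  have h0 : ‖r • u‖ ≠ 0 := by rw [hn]; exact hr0.ne'
  have e1 : ∀ᶠ x in 𝓝 (r • u), ‖x‖ ∈ interior (S (some ⟨(m, k), u, hu, hud⟩)) :=
    continuous_norm.continuousAt (isOpen_interior.mem_nhds (by rwa [hn]))
  have e2 : ∀ᶠ x in 𝓝 (r • u), dist (‖x‖⁻¹ • x) (c m) < 1 / ((k : ℝ) + 1) := by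
    have hcont : ContinuousAt (fun x : EuclideanSpace ℝ (Fin n) => dist (‖x‖⁻¹ • x) (c m))
        (r • u) := ((continuous_norm.continuousAt.inv₀ h0).smul continuousAt_id).dist
          continuousAt_const
    refine hcont.eventually (gt_mem_nhds ?_)
    show dist (‖r • u‖⁻¹ • (r • u)) (c m) < _
    rwa [hn, inv_smul_smul₀ hr0.ne']
  have e3 : ∀ᶠ x in 𝓝 (r • u), ‖x‖ ≠ 0 := continuous_norm.continuousAt.eventually_ne h0
  filter_upwards [e1, e2, e3] with x h1 h2 h3
  have := interior_subset h1 (‖x‖⁻¹ • x) (by rw [norm_smul, norm_inv, norm_norm,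
    inv_mul_cancel₀ h3]) h2.le
  rwa [smul_inv_smul₀ h3] at this

/-- Near every point of a small sphere, a nonzero polynomial is not too small somewhere on the
sphere. -/
lemma eventually_exists_lt_abs_polyVal {f : MvPolynomial (Fin n) ℝ} (hf : f ≠ 0) (L : ℕ) :
    ∀ᶠ B : ℕ in atTop, ∀ᶠ r : ℝ in 𝓝[>] 0, ∀ a : EuclideanSpace ℝ (Fin n), ‖a‖ = r →
      ∃ x : EuclideanSpace ℝ (Fin n), ‖x‖ = r ∧ dist x a ≤ r ^ L ∧ r ^ B < |polyVal f x| := by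
  have hT : SignDetermined bivariateEv fun ω : ℝ × ℝ => ∃ a : EuclideanSpace ℝ (Fin n),
      ‖a‖ ^ 2 = ω.1 ^ 2 ∧ ∀ x : EuclideanSpace ℝ (Fin n),
        ‖x‖ ^ 2 = ω.1 ^ 2 → ‖x - a‖ ^ 2 ≤ (ω.1 ^ L) ^ 2 →
          -ω.2 ≤ polyVal f x ∧ polyVal f x ≤ ω.2 := by
    have hc : ∀ c : ℝ, IsPolyFun (mvPolynomialEv n (mvPolynomialEv n bivariateEv)) fun _ => c :=
      fun c => (isPolyFun_bivariateEv_const c).fst.fst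
    have hr := isPolyFun_bivariateEv_fst.fst (n := n)
    have ht := (isPolyFun_bivariateEv_snd.fst (n := n)).fst (n := n)
    have hfx := IsPolyFun.mvPolynomial_eval hc IsPolyFun.coord f
    refine SignDetermined.exists_euclidean (G := fun ω : (ℝ × ℝ) × EuclideanSpace ℝ (Fin n) =>
      ‖ω.2‖ ^ 2 = ω.1.1 ^ 2 ∧ ∀ x : EuclideanSpace ℝ (Fin n), ‖x‖ ^ 2 = ω.1.1 ^ 2 →
        ‖x - ω.2‖ ^ 2 ≤ (ω.1.1 ^ L) ^ 2 → -ω.1.2 ≤ polyVal f x ∧ polyVal f x ≤ ω.1.2) ?_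
    refine ((IsPolyFun.norm_sq IsPolyFun.coord).eq (hr.pow 2)).and ?_
    refine SignDetermined.forall_euclidean
      (G := fun ω : ((ℝ × ℝ) × (Fin n → ℝ)) × EuclideanSpace ℝ (Fin n) =>
        ‖ω.2‖ ^ 2 = ω.1.1.1 ^ 2 → ‖ω.2 - WithLp.toLp 2 ω.1.2‖ ^ 2 ≤ (ω.1.1.1 ^ L) ^ 2 →
          -ω.1.1.2 ≤ polyVal f ω.2 ∧ polyVal f ω.2 ≤ ω.1.1.2) ?_
    exact ((IsPolyFun.norm_sq IsPolyFun.coord).eq (hr.fst.pow 2)).imp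
      (((IsPolyFun.norm_sub_sq IsPolyFun.coord (fun i => (IsPolyFun.coord i).fst)).le
        ((hr.fst.pow L).pow 2)).imp ((ht.neg.le hfx).and (hfx.le ht)))
  obtain ⟨τ, hτ⟩ := hT.eventually_const
  by_cases hτ' : τ
  · refine absurd (MvPolynomial.eq_zero_of_vanishes_on_spheres f ?_) hf
    obtain ⟨M, hM⟩ := hτ.exists
    filter_upwards [hM, self_mem_nhdsWithin] with r hr (hr0 : 0 < r)
    simp only [hτ', iff_true] at hr
    have ht : ∀ k : ℕ, 0 < r ^ M / (k + 1) ∧ r ^ M / (k + 1) ≤ r ^ M := fun k =>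
      ⟨by positivity, div_le_self (by positivity) (by linarith [k.cast_nonneg (α := ℝ)])⟩
    choose a ha hax using fun k : ℕ => hr (r ^ M / (k + 1)) (ht k).1 (ht k).2
    have has : ∀ k, a k ∈ sphere (0 : EuclideanSpace ℝ (Fin n)) r := fun k => by
      simpa [pow_left_inj₀ (norm_nonneg _) hr0.le two_ne_zero] using ha k
    obtain ⟨y, hy, φ, hφ, hlim⟩ := (isCompact_sphere _ _).tendsto_subseq has
    have ht0 : Tendsto (fun k : ℕ => r ^ M / ((k : ℝ) + 1)) atTop (𝓝 0) :=
      tendsto_const_nhds.div_atTop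
        (tendsto_atTop_add_const_right _ _ tendsto_natCast_atTop_atTop)
    refine ⟨y, r ^ L, by positivity, by simpa using hy, fun x hx hxy => ?_⟩
    have hd : Tendsto (fun k => ‖x - a (φ k)‖) atTop (𝓝 ‖x - y‖) := (hlim.const_sub x).norm
    rw [dist_eq_norm] at hxy
    have hev : ∀ᶠ k in atTop, |polyVal f x| ≤ r ^ M / ((φ k : ℝ) + 1) := by
      filter_upwards [hd.eventually (gt_mem_nhds hxy)] with k hk
      exact abs_le.2 (hax (φ k) x (by rw [hx]) (pow_le_pow_left₀ (norm_nonneg _) hk.le 2))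
    have := ge_of_tendsto (ht0.comp hφ.tendsto_atTop) hev
    exact abs_eq_zero.1 (le_antisymm this (abs_nonneg _))
  · filter_upwards [hτ] with B hB
    filter_upwards [hB, self_mem_nhdsWithin] with r hr (hr0 : 0 < r) a ha
    by_contra! hcon
    refine hτ' ((hr (r ^ B) (by positivity) le_rfl).1 ⟨a, by rw [ha], fun x hx hxa => ?_⟩)
    refine abs_le.1 (hcon x ((pow_left_inj₀ (norm_nonneg _) hr0.le two_ne_zero).1 hx) ?_)
    rw [dist_eq_norm]
    exact (pow_le_pow_iff_left₀ (norm_nonneg _) (by positivity) two_ne_zero).1 hxa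

end Lojasiewicz

section Approximation

open Topology

/-- On every small sphere around the origin, the points of `X` are within `r ^ s` of points of
`Y`, where `r` is the radius. -/
def SphericallyClose {E : Type*} [SeminormedAddCommGroup E] (s : ℕ) (X Y : Set E) : Prop :=
  ∀ᶠ r : ℝ in 𝓝[>] 0, ∀ x ∈ X, ‖x‖ = r → ∃ y ∈ Y, ‖y‖ = r ∧ dist x y ≤ r ^ s

lemma SphericallyClose.trans {E : Type*} [SeminormedAddCommGroup E] {s : ℕ} {X Y Z : Set E}
    (hXY : SphericallyClose (s + 1) X Y) (hYZ : SphericallyClose (s + 1) Y Z) :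
    SphericallyClose s X Z := by
  filter_upwards [hXY, hYZ, self_mem_nhdsWithin, eventually_lt_nhdsGT_zero one_half_pos]
    with r h₁ h₂ (hr0 : 0 < r) hr x hx hxr
  obtain ⟨y, hy, hyr, hxy⟩ := h₁ x hx hxr
  obtain ⟨z, hz, hzr, hyz⟩ := h₂ y hy hyr
  refine ⟨z, hz, hzr, (dist_triangle x y z).trans ?_⟩
  have : r ^ (s + 1) ≤ r ^ s * (1 / 2) := by
    rw [pow_succ]
    gcongr
  linarith

/-- The intermediate value theorem along an arc of a sphere. -/
lemma exists_norm_eq_dist_le_eq_zero {E : Type*} [NormedAddCommGroup E] [NormedSpace ℝ E]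
    {F : E → ℝ} (hF : Continuous F) {a x : E} {r : ℝ} (ha : ‖a‖ = r) (hx : ‖x‖ = r)
    (hd : dist x a < r) (hFa : F a ≤ 0) (hFx : 0 ≤ F x) :
    ∃ y, ‖y‖ = r ∧ dist y a ≤ 2 * dist x a ∧ F y = 0 := by
  have hr : 0 < r := dist_nonneg.trans_lt hd
  set z : ℝ → E := fun t => a + t • (x - a) with hz
  have hza : ∀ t ∈ Icc (0 : ℝ) 1, ‖z t - a‖ ≤ dist x a := fun t ht => by
    rw [hz, add_sub_cancel_left, norm_smul, Real.norm_of_nonneg ht.1, dist_eq_norm]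
    exact mul_le_of_le_one_left (norm_nonneg _) ht.2
  have hz0 : ∀ t ∈ Icc (0 : ℝ) 1, ‖z t‖ ≠ 0 := fun t ht h0 => by
    have := hza t ht
    rw [norm_eq_zero.1 h0, zero_sub, norm_neg, ha] at this
    linarith
  have hzc : Continuous z := by fun_prop
  have hc : ContinuousOn (fun t => F ((r / ‖z t‖) • z t)) (Icc 0 1) :=
    hF.comp_continuousOn
      ((continuousOn_const.div hzc.norm.continuousOn hz0).smul hzc.continuousOn)
  have h0 : z 0 = a := by simp [hz]
  have h1 : z 1 = x := by simp [hz]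
  obtain ⟨t, ht, hFt⟩ := intermediate_value_Icc zero_le_one hc
    (show (0 : ℝ) ∈ _ by simp [h0, h1, ha, hx, hr.ne', hFa, hFx])
  refine ⟨_, ?_, ?_, hFt⟩
  · rw [norm_smul, norm_div, norm_norm, Real.norm_of_nonneg hr.le, div_mul_cancel₀ _ (hz0 t ht)]
  · have e : (r / ‖z t‖) • z t - z t = (r / ‖z t‖ - 1) • z t := by rw [sub_smul, one_smul]
    have h2 : ‖(r / ‖z t‖) • z t - z t‖ ≤ ‖z t - a‖ := by
      rw [e, norm_smul, ← norm_norm (z t), ← norm_mul, norm_norm, sub_mul, one_mul,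
        div_mul_cancel₀ _ (hz0 t ht), ← ha, norm_sub_rev (z t)]
      exact abs_norm_sub_norm_le a (z t)
    rw [dist_eq_norm]
    have := norm_sub_le_norm_sub_add_norm_sub ((r / ‖z t‖) • z t) (z t) a
    linarith [hza t ht]

variable {n : ℕ}

lemma eventually_mul_polyVal_le (g : MvPolynomial (Fin n) ℝ) {c : ℝ} (hc : 0 < c) :
    ∀ᶠ r : ℝ in 𝓝[>] 0, ∀ x : EuclideanSpace ℝ (Fin n), ‖x‖ = r → r * polyVal g x ≤ c := by
  have : Tendsto (fun x : EuclideanSpace ℝ (Fin n) => ‖x‖ * polyVal g x) (𝓝 0) (𝓝 0) := by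
    have : Continuous fun x : EuclideanSpace ℝ (Fin n) => ‖x‖ * polyVal g x :=
      continuous_norm.mul (continuous_polyVal g)
    simpa using this.tendsto 0
  obtain ⟨δ, hδ, hball⟩ := Metric.eventually_nhds_iff_ball.1 (this.eventually (gt_mem_nhds hc))
  filter_upwards [eventually_lt_nhdsGT_zero hδ] with r hr x hx
  have := hball x (by simpa [hx] using hr)
  rw [hx] at this
  exact this.le

lemma eventually_mul_abs_polyVal_sub_le (g : MvPolynomial (Fin n) ℝ) :
    ∀ᶠ r : ℝ in 𝓝[>] 0, ∀ x y : EuclideanSpace ℝ (Fin n), ‖x‖ = r → ‖y‖ = r →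
      r * |polyVal g x - polyVal g y| ≤ dist x y := by
  obtain ⟨C, t, ht, hC⟩ := ((contDiff_polyVal g).contDiffAt (x := 0)).exists_lipschitzOnWith
  obtain ⟨δ, hδ, hball⟩ := Metric.mem_nhds_iff.1 ht
  have hC1 : (0 : ℝ) < 1 / (C + 1) := by positivity
  filter_upwards [eventually_lt_nhdsGT_zero hδ, eventually_lt_nhdsGT_zero hC1,
    self_mem_nhdsWithin] with r hr hrC (hr0 : 0 < r) x y hx hy
  have h1 := hC.dist_le_mul x (hball (by simpa [hx] using hr)) y (hball (by simpa [hy] using hr))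
  rw [Real.dist_eq] at h1
  have h2 : r * C ≤ 1 := by
    rw [lt_div_iff₀ (by positivity)] at hrC
    linarith
  calc r * |polyVal g x - polyVal g y| ≤ r * (C * dist x y) := by gcongr
    _ = r * C * dist x y := by ring
    _ ≤ dist x y := mul_le_of_le_one_left dist_nonneg h2

/-- The polynomial `∑ X i ^ 2`. -/
noncomputable def normSqPoly (n : ℕ) : MvPolynomial (Fin n) ℝ := ∑ i, .X i ^ 2

lemma polyVal_normSqPoly (x : EuclideanSpace ℝ (Fin n)) :
    polyVal (normSqPoly n) x = ‖x‖ ^ 2 := by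
  simp [normSqPoly, polyVal, EuclideanSpace.real_norm_sq_eq]

/-- One inequality defining a semialgebraic subset of a hypersurface can be absorbed into the
equation of a nearby hypersurface. -/
lemma exists_sphericallyClose_drop_inequality (hn : 0 < n) {κ : Type} [Finite κ]
    {f : MvPolynomial (Fin n) ℝ} (hf : f ≠ 0) (g : MvPolynomial (Fin n) ℝ)
    (h : κ → MvPolynomial (Fin n) ℝ) (s : ℕ) :
    ∃ F : MvPolynomial (Fin n) ℝ, F ≠ 0 ∧ ∃ h' : κ → MvPolynomial (Fin n) ℝ,
      SphericallyClose s {x | polyVal f x = 0 ∧ 0 ≤ polyVal g x ∧ ∀ i, 0 ≤ polyVal (h i) x}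
        {x | polyVal F x = 0 ∧ ∀ i, 0 ≤ polyVal (h' i) x} ∧
      SphericallyClose s {x | polyVal F x = 0 ∧ ∀ i, 0 ≤ polyVal (h' i) x}
        {x | polyVal f x = 0 ∧ 0 ≤ polyVal g x ∧ ∀ i, 0 ≤ polyVal (h i) x} := by
  obtain ⟨M, hM⟩ := (eventually_exists_dist_le_of_almost_nonneg
    (fun o : Option (Option (Option κ)) =>
      o.elim f fun o => o.elim (-f) fun o => o.elim g h) s).exists
  obtain ⟨B, hB, hMB⟩ := ((eventually_exists_lt_abs_polyVal hf (2 * M + s + 2)).and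
    (eventually_ge_atTop M)).exists
  set F : MvPolynomial (Fin n) ℝ :=
    f ^ 2 - normSqPoly n ^ (B + 1) * (g + normSqPoly n ^ M) with hFdef
  have hF : ∀ (r : ℝ) (x : EuclideanSpace ℝ (Fin n)), ‖x‖ = r →
      polyVal F x = polyVal f x ^ 2 - r ^ (2 * B) * r * (r * polyVal g x + r * r ^ (2 * M)) := by
    intro r x hx
    have h1 := polyVal_normSqPoly x
    rw [hx] at h1
    simp only [polyVal] at h1
    simp only [polyVal, hFdef, map_sub, map_mul, map_pow, map_add, h1]
    ring
  have hpos : ∀ᶠ r : ℝ in 𝓝[>] 0, r < 1 / 2 ∧ (∀ x : EuclideanSpace ℝ (Fin n), ‖x‖ = r →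
      r * polyVal g x + r * r ^ (2 * M) ≤ 1) ∧
      ∀ x : EuclideanSpace ℝ (Fin n), ‖x‖ = r → r ^ B < |polyVal f x| → 0 < polyVal F x := by
    filter_upwards [eventually_mul_polyVal_le g one_half_pos,
      eventually_lt_nhdsGT_zero one_half_pos, self_mem_nhdsWithin] with r hg hr (hr0 : 0 < r)
    have hle : ∀ x : EuclideanSpace ℝ (Fin n), ‖x‖ = r →
        r * polyVal g x + r * r ^ (2 * M) ≤ 1 := fun x hx => by
      have : r * r ^ (2 * M) ≤ r :=
        mul_le_of_le_one_right hr0.le (pow_le_one₀ hr0.le (by linarith))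
      linarith [hg x hx]
    refine ⟨hr, hle, fun x hx hfx => ?_⟩
    rw [hF r x hx, sub_pos, ← sq_abs (polyVal f x)]
    calc r ^ (2 * B) * r * (r * polyVal g x + r * r ^ (2 * M)) ≤ r ^ (2 * B) * r * 1 := by
          gcongr; exact hle x hx
      _ ≤ r ^ (2 * B) * 1 * 1 := by gcongr; linarith
      _ = (r ^ B) ^ 2 := by ring
      _ < _ := by gcongr
  refine ⟨F, fun hF0 => ?_, fun i => h i + normSqPoly n ^ M, ?_, ?_⟩
  · obtain ⟨r, hBr, ⟨-, -, hFr⟩, hr0 : 0 < r⟩ := (hB.and (hpos.and self_mem_nhdsWithin)).exists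
    have : Nontrivial (EuclideanSpace ℝ (Fin n)) :=
      have : Nonempty (Fin n) := ⟨⟨0, hn⟩⟩
      inferInstance
    obtain ⟨a, ha⟩ := exists_norm_eq (EuclideanSpace ℝ (Fin n)) hr0.le
    obtain ⟨x, hx, -, hfx⟩ := hBr a ha
    have := hFr x hx hfx
    simp [hF0, polyVal] at this
  · filter_upwards [hB, hpos, self_mem_nhdsWithin,
      eventually_all.2 fun i => eventually_mul_abs_polyVal_sub_le (h i)]
      with r hBr ⟨hr, _, hFr⟩ (hr0 : 0 < r) hlip a ⟨hfa, hga, hha⟩ ha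
    obtain ⟨x, hx, hxa, hfx⟩ := hBr a ha
    have hL : 2 * r ^ (2 * M + s + 2) ≤ r ^ (2 * M + s + 1) := by
      rw [pow_succ r (2 * M + s + 1)]
      nlinarith [pow_pos hr0 (2 * M + s + 1)]
    have hL1 : r ^ (2 * M + s + 1) ≤ r := pow_le_of_le_one hr0.le (by linarith) (by omega)
    have hL0 : 0 < r ^ (2 * M + s + 2) := by positivity
    have hFa : polyVal F a ≤ 0 := by
      rw [hF r a ha, hfa, zero_pow two_ne_zero, zero_sub, neg_nonpos]
      positivity
    obtain ⟨y, hy, hya, hFy⟩ := exists_norm_eq_dist_le_eq_zero (continuous_polyVal F) ha hx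
      (by linarith) hFa (hFr x hx hfx).le
    have hya' : dist y a ≤ r ^ (2 * M + s + 1) := by linarith
    refine ⟨y, ⟨hFy, fun i => ?_⟩, hy, ?_⟩
    · have h1 := hlip i y a hy ha
      have h2 : r ^ (2 * M + s + 1) ≤ r * r ^ (2 * M) := by
        rw [← pow_succ']
        exact pow_le_pow_of_le_one hr0.le (by linarith) (by omega)
      have h3 : |polyVal (h i) y - polyVal (h i) a| ≤ r ^ (2 * M) :=
        le_of_mul_le_mul_left (h1.trans (hya'.trans h2)) hr0
      have h4 := polyVal_normSqPoly y
      rw [hy] at h4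
      have h5 : polyVal (h i + normSqPoly n ^ M) y = polyVal (h i) y + r ^ (2 * M) := by
        rw [pow_mul, ← h4]
        simp [polyVal]
      rw [h5]
      linarith [(abs_le.1 h3).1, hha i]
    · rw [dist_comm]
      exact hya'.trans (pow_le_pow_of_le_one hr0.le (by linarith) (by omega))
  · filter_upwards [hM, hpos, self_mem_nhdsWithin]
      with r hMr ⟨hr, hgr, _⟩ (hr0 : 0 < r) y ⟨hFy, hhy⟩ hy
    have h2M : r ^ (2 * M) ≤ r ^ M := pow_le_pow_of_le_one hr0.le (by linarith) (by omega)
    have hfy : polyVal f y ^ 2 =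
        r ^ (2 * B) * r * (r * polyVal g y + r * r ^ (2 * M)) := by
      rw [hF r y hy] at hFy
      linarith
    have hg : -r ^ M ≤ polyVal g y := by
      have h1 : 0 ≤ r ^ (2 * B) * r * (r * polyVal g y + r * r ^ (2 * M)) :=
        hfy ▸ sq_nonneg _
      have h2 : 0 ≤ r * (polyVal g y + r ^ (2 * M)) := by
        rw [mul_add]
        exact nonneg_of_mul_nonneg_right h1 (by positivity)
      have := nonneg_of_mul_nonneg_right h2 hr0
      linarith
    have hfM : |polyVal f y| ≤ r ^ M := by
      refine abs_le_of_sq_le_sq ?_ (by positivity)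
      calc polyVal f y ^ 2 ≤ r ^ (2 * B) * r * 1 := by rw [hfy]; gcongr; exact hgr y hy
        _ ≤ r ^ (2 * B) * 1 * 1 := by gcongr; linarith
        _ = r ^ (2 * B) := by ring
        _ ≤ r ^ (2 * M) := pow_le_pow_of_le_one hr0.le (by linarith) (by omega)
        _ = (r ^ M) ^ 2 := by ring
    obtain ⟨a, ha, hah, hya⟩ := hMr y hy (by
      rintro (_ | _ | _ | i)
      · exact (abs_le.1 hfM).1
      · have := (abs_le.1 hfM).2
        simpa [polyVal] using this
      · exact hg
      · have h4 := polyVal_normSqPoly y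
        rw [hy] at h4
        have h5 : polyVal (h i + normSqPoly n ^ M) y = polyVal (h i) y + r ^ (2 * M) := by
          rw [pow_mul, ← h4]
          simp [polyVal]
        have h6 := hhy i
        rw [h5] at h6
        show _ ≤ polyVal (h i) y
        linarith)
    refine ⟨a, ⟨le_antisymm ?_ (hah none), hah (some (some none)),
      fun i => hah (some (some (some i)))⟩, ha, hya⟩
    have := hah (some none)
    simpa [polyVal] using this

/-- A semialgebraic subset of a hypersurface given by polynomial inequalities is close, on small
spheres, to a hypersurface. -/
lemma exists_sphericallyClose_zeroLocus (hn : 0 < n) :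
    ∀ (l : ℕ) {f : MvPolynomial (Fin n) ℝ}, f ≠ 0 → ∀ (h : Fin l → MvPolynomial (Fin n) ℝ)
      (s : ℕ), ∃ P : MvPolynomial (Fin n) ℝ,
        SphericallyClose s {x | polyVal f x = 0 ∧ ∀ i, 0 ≤ polyVal (h i) x}
          {x | polyVal P x = 0} ∧
        SphericallyClose s {x | polyVal P x = 0}
          {x | polyVal f x = 0 ∧ ∀ i, 0 ≤ polyVal (h i) x} := by
  intro l
  induction l with
  | zero =>
    intro f _ h s
    refine ⟨f, ?_⟩
    simp only [IsEmpty.forall_iff, and_true, and_self]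
    filter_upwards [self_mem_nhdsWithin] with r (hr : 0 < r) x hx hxr
    exact ⟨x, hx, hxr, by rw [dist_self]; positivity⟩
  | succ l ih =>
    intro f hf h s
    obtain ⟨F, hF, h', h₁, h₂⟩ := exists_sphericallyClose_drop_inequality hn hf (h 0)
      (fun i : Fin l => h i.succ) (s + 1)
    obtain ⟨P, h₃, h₄⟩ := ih hF h' (s + 1)
    simp only [Fin.forall_fin_succ]
    exact ⟨P, h₁.trans h₃, h₄.trans h₂⟩

/-- A basic closed semialgebraic set with empty interior lies in a hypersurface. -/
lemma exists_ne_zero_forall_polyVal_eq_zero {κ : Type} [Finite κ]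
    (q : κ → MvPolynomial (Fin n) ℝ)
    (hq : interior {x : EuclideanSpace ℝ (Fin n) | ∀ i, 0 ≤ polyVal (q i) x} = ∅) :
    ∃ f : MvPolynomial (Fin n) ℝ, f ≠ 0 ∧
      ∀ x, (∀ i, 0 ≤ polyVal (q i) x) → polyVal f x = 0 := by
  classical
  have := Fintype.ofFinite κ
  refine ⟨∏ i with q i ≠ 0, q i,
    Finset.prod_ne_zero_iff.2 fun i hi => (Finset.mem_filter.1 hi).2, fun x hx => ?_⟩
  by_contra hne
  rw [polyVal, map_prod, ← ne_eq, Finset.prod_ne_zero_iff] at hne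
  refine (eq_empty_iff_forall_notMem.1 hq x) (mem_interior_iff_mem_nhds.2 ?_)
  refine eventually_all.2 fun i => ?_
  by_cases hi : q i = 0
  · exact Eventually.of_forall fun y => by simp [hi, polyVal]
  · have : 0 < polyVal (q i) x := (hx i).lt_of_ne' (hne i (by simpa using hi))
    exact ((continuous_polyVal (q i)).continuousAt.eventually (lt_mem_nhds this)).mono
      fun y hy => le_of_lt hy

lemma SphericallyClose.iUnion {E : Type*} [SeminormedAddCommGroup E] {ι : Type*} [Finite ι]
    {s : ℕ} {X Y : ι → Set E} (h : ∀ j, SphericallyClose s (X j) (Y j)) :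
    SphericallyClose s (⋃ j, X j) (⋃ j, Y j) := by
  filter_upwards [eventually_all.2 h] with r hr x hx hxr
  obtain ⟨j, hj⟩ := mem_iUnion.1 hx
  obtain ⟨y, hy, hyr⟩ := hr j x hj hxr
  exact ⟨y, mem_iUnion.2 ⟨j, hy⟩, hyr⟩

lemma SphericallyClose.tendsto_hausdorffDist_div {E : Type*} [SeminormedAddCommGroup E]
    {k : ℕ} {s : ℝ} (hs : s + 1 ≤ k) {X Y : Set E} (hXY : SphericallyClose k X Y)
    (hYX : SphericallyClose k Y X) :
    Tendsto (fun r : ℝ => hausdorffDist (X ∩ sphere 0 r) (Y ∩ sphere 0 r) / r ^ s)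
      (𝓝[>] 0) (𝓝 0) := by
  have hid : Tendsto (fun r : ℝ => r) (𝓝[>] 0) (𝓝 0) := tendsto_id.mono_left nhdsWithin_le_nhds
  refine tendsto_of_tendsto_of_tendsto_of_le_of_le' tendsto_const_nhds hid ?_ ?_
  · filter_upwards [self_mem_nhdsWithin] with r (hr : 0 < r)
    exact div_nonneg hausdorffDist_nonneg (by positivity)
  · filter_upwards [hXY, hYX, self_mem_nhdsWithin, eventually_lt_nhdsGT_zero one_pos]
      with r h₁ h₂ (hr : 0 < r) hr1
    rw [div_le_iff₀ (by positivity)]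
    calc hausdorffDist (X ∩ sphere 0 r) (Y ∩ sphere 0 r) ≤ r ^ k := by
          refine hausdorffDist_le_of_mem_dist (by positivity) (fun x hx => ?_) fun y hy => ?_
          · obtain ⟨y, hy, hyr, hd⟩ := h₁ x hx.1 (by simpa using hx.2)
            exact ⟨y, ⟨hy, by simpa using hyr⟩, hd⟩
          · obtain ⟨x, hx, hxr, hd⟩ := h₂ y hy.1 (by simpa using hy.2)
            exact ⟨x, ⟨hx, by simpa using hxr⟩, hd⟩
      _ = r ^ (k : ℝ) := (Real.rpow_natCast r k).symm
      _ ≤ r ^ (s + 1) := Real.rpow_le_rpow_of_exponent_ge hr hr1.le hs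
      _ = r * r ^ s := by rw [Real.rpow_add hr, Real.rpow_one, mul_comm]

end Approximation

/-- **Theorem 2.3 (Ferrarotti–Fortuna–Wilson, [FFW1]).**
Let `A ⊆ ℝ^n` be a closed semialgebraic set presented by finitely many polynomial
inequalities, with `0 ∈ A` a non-isolated point of `A`, and assume `A` has empty interior
(codimension `≥ 1`). Then for every `s ≥ 1` there is a real polynomial `P` vanishing at
`0` whose zero set `Y = P⁻¹(0)` accumulates at `0`, has nonempty intersection with all
small spheres (as does `A`), and satisfies `D(A ∩ S_r, Y ∩ S_r) / r^s → 0` as `r → 0⁺`. -/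
theorem algebraic_approximation_of_semialgebraic
    {n : ℕ} (N : ℕ) (m : Fin N → ℕ)
    (q : (j : Fin N) → Fin (m j) → MvPolynomial (Fin n) ℝ)
    (A : Set (EuclideanSpace ℝ (Fin n)))
    (hApres : A = ⋃ j : Fin N, {x : EuclideanSpace ℝ (Fin n) |
        ∀ i : Fin (m j), 0 ≤ MvPolynomial.eval ((WithLp.equiv 2 (Fin n → ℝ)) x) (q j i)})
    (h0A : (0 : EuclideanSpace ℝ (Fin n)) ∈ A)
    (h0acc : (0 : EuclideanSpace ℝ (Fin n)) ∈ closure (A \ {0}))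
    (hcodim : interior A = ∅)
    (s : ℝ) (hs : 1 ≤ s) :
    ∃ (P : MvPolynomial (Fin n) ℝ) (Y : Set (EuclideanSpace ℝ (Fin n))),
      MvPolynomial.eval (0 : Fin n → ℝ) P = 0 ∧
      Y = {x : EuclideanSpace ℝ (Fin n) |
            MvPolynomial.eval ((WithLp.equiv 2 (Fin n → ℝ)) x) P = 0} ∧
      (0 : EuclideanSpace ℝ (Fin n)) ∈ closure (Y \ {0}) ∧
      (∃ ε > 0, ∀ r : ℝ, 0 < r → r < ε →
        (A ∩ Metric.sphere (0 : EuclideanSpace ℝ (Fin n)) r).Nonempty ∧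
        (Y ∩ Metric.sphere (0 : EuclideanSpace ℝ (Fin n)) r).Nonempty) ∧
      Tendsto
        (fun r : ℝ => Metric.hausdorffDist
            (A ∩ Metric.sphere (0 : EuclideanSpace ℝ (Fin n)) r)
            (Y ∩ Metric.sphere (0 : EuclideanSpace ℝ (Fin n)) r) / r ^ s)
        (nhdsWithin 0 (Set.Ioi 0)) (nhds 0) := by
  replace hApres : A = ⋃ j : Fin N, {x | ∀ i : Fin (m j), 0 ≤ polyVal (q j i) x} := hApres
  have hacc : ∀ ε > 0, ∃ x : EuclideanSpace ℝ (Fin n), x ≠ 0 ∧ ‖x‖ < ε ∧ x ∈ A := fun ε hε => by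
    obtain ⟨x, hx, hxε⟩ := Metric.mem_closure_iff.1 h0acc ε hε
    exact ⟨x, hx.2, by simpa using hxε, hx.1⟩
  have hn : 0 < n := by
    obtain ⟨x, hx, -⟩ := hacc 1 one_pos
    rcases n.eq_zero_or_pos with rfl | hn
    · exact absurd (Subsingleton.elim x 0) hx
    · exact hn
  have hf : ∀ j, ∃ f : MvPolynomial (Fin n) ℝ, f ≠ 0 ∧
      ∀ x, (∀ i, 0 ≤ polyVal (q j i) x) → polyVal f x = 0 := fun j =>
    exists_ne_zero_forall_polyVal_eq_zero (q j) <| subset_empty_iff.1 <|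
      (interior_mono (hApres ▸ subset_iUnion_of_subset j subset_rfl)).trans hcodim.subset
  choose f hf0 hf using hf
  choose P hAP hPA using fun j =>
    exists_sphericallyClose_zeroLocus hn (m j) (hf0 j) (q j) (⌈s⌉₊ + 1)
  have hset : ∀ j, {x | polyVal (f j) x = 0 ∧ ∀ i, 0 ≤ polyVal (q j i) x} =
      {x | ∀ i, 0 ≤ polyVal (q j i) x} := fun j =>
    Set.ext fun x => and_iff_right_of_imp (hf j x)
  simp only [hset] at hAP hPA
  set Y : Set (EuclideanSpace ℝ (Fin n)) := {x | polyVal (∏ j, P j) x = 0} with hY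
  have hYU : Y = ⋃ j, {x | polyVal (P j) x = 0} := by
    ext x
    simp [hY, polyVal, map_prod, Finset.prod_eq_zero_iff]
  have hAY := SphericallyClose.iUnion hAP
  have hYA := SphericallyClose.iUnion hPA
  rw [← hApres, ← hYU] at hAY hYA
  have hAS : ∀ᶠ r : ℝ in nhdsWithin 0 (Ioi 0), ∃ x ∈ A, ‖x‖ = r := by
    have := eventually_exists_norm_eq q (by simpa [hApres] using hacc)
    filter_upwards [this] with r ⟨x, hx, hxA⟩
    exact ⟨x, hApres ▸ mem_iUnion.2 hxA, hx⟩
  have hS : ∀ᶠ r : ℝ in nhdsWithin 0 (Ioi 0), (A ∩ sphere 0 r).Nonempty ∧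
      (Y ∩ sphere 0 r).Nonempty := by
    filter_upwards [hAS, hAY] with r ⟨x, hxA, hx⟩ hr
    obtain ⟨y, hyY, hy, -⟩ := hr x hxA hx
    exact ⟨⟨x, hxA, by simpa using hx⟩, ⟨y, hyY, by simpa using hy⟩⟩
  have hYacc : (0 : EuclideanSpace ℝ (Fin n)) ∈ closure (Y \ {0}) := by
    refine Metric.mem_closure_iff.2 fun ε hε => ?_
    obtain ⟨r, ⟨-, y, hyY, hy⟩, hrε, hr0 : 0 < r⟩ :=
      (hS.and ((eventually_lt_nhdsGT_zero hε).and self_mem_nhdsWithin)).exists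
    have hy : ‖y‖ = r := by simpa using hy
    refine ⟨y, ⟨hyY, fun h => hr0.ne' ?_⟩, by simpa [hy] using hrε⟩
    rw [← hy, mem_singleton_iff.1 h, norm_zero]
  have hYc : IsClosed Y := isClosed_eq (continuous_polyVal _) continuous_const
  obtain ⟨ε, hε, hsub⟩ := mem_nhdsGT_iff_exists_Ioo_subset.1 hS
  refine ⟨∏ j, P j, Y, hYc.closure_subset_iff.2 sdiff_subset hYacc, rfl, hYacc,
    ⟨ε, hε, fun r hr0 hrε => hsub ⟨hr0, hrε⟩⟩,
    hAY.tendsto_hausdorffDist_div ?_ hYA⟩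
  push_cast
  linarith [Nat.le_ceil s]
end

section
/- Let φ : ℝ^n → ℝ be real-analytic at 0 with φ(0) = 0, with convergent power series p at 0, and for k ∈ ℕ let T^k φ denote the Taylor polynomial of φ at 0 of degree k (the sum of the terms of p of degree ≤ k). Let α > 0 be a real number and let Z ⊆ ℝ^n be a set such that ‖x‖^α < |φ(x)| for all x ∈ Z \ {0}. Then for every integer k > α there exists ε > 0 such that for all x ∈ Z with 0 < ‖x‖ < ε, the numbers φ(x) and T^k φ(x) have the same strict sign, i.e. φ(x) · T^k φ(x) > 0. -/
open Metric Filter Set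

/-- A real number closer to `a` than `0` is has the same strict sign as `a`. -/
theorem mul_pos_of_abs_sub_lt_abs {a b : ℝ} (h : |a - b| < |a|) : 0 < a * b := by
  have hsq := sq_lt_sq.2 h
  nlinarith [sq_nonneg b]

/-- **Core analytic content of Lemma 3.5 (Ferrarotti–Fortuna–Wilson):**
if `φ` is analytic at `0` with power series `p`, `φ(0) = 0`, and `‖x‖^α < |φ(x)|` on
`Z \ {0}`, then for every integer `k > α` the Taylor polynomial `T^k φ = p.partialSum (k+1)`
has the same strict sign as `φ` at all points of `Z \ {0}` sufficiently close to `0`. -/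
theorem taylor_polynomial_same_sign
    {n : ℕ} (φ : EuclideanSpace ℝ (Fin n) → ℝ)
    (p : FormalMultilinearSeries ℝ (EuclideanSpace ℝ (Fin n)) ℝ)
    (hφ : HasFPowerSeriesAt φ p 0) (hφ0 : φ 0 = 0)
    (α : ℝ) (hα : 0 < α)
    (Z : Set (EuclideanSpace ℝ (Fin n)))
    (hZ : ∀ x ∈ Z, x ≠ 0 → ‖x‖ ^ α < |φ x|)
    (k : ℕ) (hk : α < (k : ℝ)) :
    ∃ ε > 0, ∀ x ∈ Z, x ≠ 0 → ‖x‖ < ε → 0 < φ x * p.partialSum (k + 1) x := by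
  obtain ⟨C, hC, hbound⟩ := (hφ.isBigO_sub_partialSum_pow (k + 1)).exists_pos
  obtain ⟨δ, hδ, hball⟩ := Metric.eventually_nhds_iff.1 hbound.bound
  refine ⟨min δ (min 1 C⁻¹), by positivity, fun x hxZ hx0 hx => ?_⟩
  obtain ⟨hxδ, hx1, hxC⟩ : ‖x‖ < δ ∧ ‖x‖ < 1 ∧ ‖x‖ < C⁻¹ := by
    simpa only [lt_min_iff] using hx
  have hpos : 0 < ‖x‖ := norm_pos_iff.2 hx0
  have hremainder : |φ x - p.partialSum (k + 1) x| ≤ C * ‖x‖ ^ (k + 1) := by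
    simpa using hball (y := x) (by simpa using hxδ)
  have hCx : C * ‖x‖ ≤ 1 := by
    simpa [hC.ne'] using mul_le_mul_of_nonneg_left hxC.le hC.le
  have hlt : |φ x - p.partialSum (k + 1) x| < |φ x| :=
    calc
      |φ x - p.partialSum (k + 1) x| ≤ C * ‖x‖ ^ (k + 1) := hremainder
      _ = C * ‖x‖ * ‖x‖ ^ k := by ring
      _ ≤ ‖x‖ ^ k := mul_le_of_le_one_left (by positivity) hCx
      _ = ‖x‖ ^ (k : ℝ) := (Real.rpow_natCast _ _).symm
      _ ≤ ‖x‖ ^ α := Real.rpow_le_rpow_of_exponent_ge hpos hx1.le hk.le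
      _ < |φ x| := hZ x hxZ hx0
  exact mul_pos_of_abs_sub_lt_abs hlt
end

section
/- Let Ω ⊆ ℝ^n be an open neighborhood of 0, let f : Ω → ℝ^m be real-analytic at 0 with f(0) = 0, and for an integer h let T^h f denote the Taylor polynomial map of f at 0 of degree h. Let C ⊆ Ω be a set with 0 ∈ C, let Z = {x ∈ C : f(x) = 0}, and suppose there is ρ > 0 such that dist(x, Z)^ρ ≤ ‖f(x)‖ for all x ∈ C. Let σ > 0 and let h be an integer with h ≥ ρσ. Then there exists ε > 0 such that every x ∈ C with 0 < ‖x‖ < ε and T^h f(x) = 0 satisfies dist(x, Z) < ‖x‖^σ; that is, near 0 the zeros of T^h f lying in C are contained in the horn-neighborhood {x : dist(x, Z) < ‖x‖^σ}. -/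
open Metric Filter Set

/-- **Truncation step in the proof of Lemma 3.7(1) (Ferrarotti–Fortuna–Wilson):**
let `f` be analytic at `0` with power series `p` and `f(0) = 0`, let `Z` be the zero set
of `f` in `C ⊆ Ω`, and assume the Łojasiewicz inequality `dist(x, Z)^ρ ≤ ‖f(x)‖` on `C`.
If `σ > 0` and `h ≥ ρσ` is an integer, then near `0` every zero of the Taylor polynomial
`T^h f = p.partialSum (h+1)` lying in `C` belongs to the horn-neighborhood
`{x : dist(x, Z) < ‖x‖^σ}`. -/
theorem taylor_zeros_in_horn_neighborhood
    {n m : ℕ} (Ω : Set (EuclideanSpace ℝ (Fin n))) (hΩ : IsOpen Ω)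
    (hΩ0 : (0 : EuclideanSpace ℝ (Fin n)) ∈ Ω)
    (f : EuclideanSpace ℝ (Fin n) → EuclideanSpace ℝ (Fin m))
    (p : FormalMultilinearSeries ℝ (EuclideanSpace ℝ (Fin n)) (EuclideanSpace ℝ (Fin m)))
    (hf : HasFPowerSeriesAt f p 0) (hf0 : f 0 = 0)
    (C : Set (EuclideanSpace ℝ (Fin n))) (hC : C ⊆ Ω)
    (h0C : (0 : EuclideanSpace ℝ (Fin n)) ∈ C)
    (Z : Set (EuclideanSpace ℝ (Fin n))) (hZ : Z = {x ∈ C | f x = 0})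
    (ρ : ℝ) (hρ : 0 < ρ)
    (hLoj : ∀ x ∈ C, Metric.infDist x Z ^ ρ ≤ ‖f x‖)
    (σ : ℝ) (hσ : 0 < σ)
    (h : ℕ) (hh : ρ * σ ≤ (h : ℝ)) :
    ∃ ε > 0, ∀ x ∈ C, 0 < ‖x‖ → ‖x‖ < ε →
      p.partialSum (h + 1) x = 0 → Metric.infDist x Z < ‖x‖ ^ σ := by
  have hbigO := hf.isBigO_sub_partialSum_pow (h + 1)
  have hlittleO : (fun y : EuclideanSpace ℝ (Fin n) => ‖y‖ ^ (h + 1)) =o[nhds 0]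
      fun y => ‖y‖ ^ h :=
    Asymptotics.isLittleO_norm_pow_norm_pow h.lt_succ_self
  have hrem := (hbigO.trans_isLittleO hlittleO).def (c := 1 / 2) (by norm_num)
  obtain ⟨δ, hδ, hball⟩ := Metric.eventually_nhds_iff.1 hrem
  refine ⟨min δ 1, lt_min hδ one_pos, fun x hxC hx0 hxε hTx => ?_⟩
  have hfx := hball (y := x) (by simpa using hxε.trans_le (min_le_left _ _))
  rw [zero_add, hTx, sub_zero, norm_pow, norm_norm] at hfx
  have hpos : 0 < ‖x‖ ^ h := pow_pos hx0 h
  refine (Real.rpow_lt_rpow_iff infDist_nonneg (Real.rpow_nonneg hx0.le σ) hρ).1 ?_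
  calc Metric.infDist x Z ^ ρ ≤ ‖f x‖ := hLoj x hxC
    _ < ‖x‖ ^ (h : ℝ) := by rw [Real.rpow_natCast]; linarith
    _ ≤ ‖x‖ ^ (σ * ρ) :=
      Real.rpow_le_rpow_of_exponent_ge hx0 (hxε.le.trans (min_le_right _ _)) (by linarith)
    _ = (‖x‖ ^ σ) ^ ρ := Real.rpow_mul hx0.le σ ρ
end

section
/- Let g, g̃ : ℝ^n → ℝ be functions, let β > 0 and τ > 1 be real numbers, and let h be an integer with h > β + 1. Suppose there exists δ > 0 such that |g(y) − g̃(y)| ≤ ‖y‖^{h−1} for all y with ‖y‖ < δ. Then there exists ε > 0 such that for every x with 0 < ‖x‖ < ε and every y with ‖y − x‖ < ‖x‖^τ, if g(y) > ‖x‖^β then g̃(y) ≥ ‖x‖^{β+1}. -/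
open Metric Filter Set

/-- **The Claim in the proof of Lemma 3.7(2) (Ferrarotti–Fortuna–Wilson), abstract form:**
let `g, g̃ : ℝ^n → ℝ`, `β > 0`, `τ > 1`, and let `h` be an integer with `h > β + 1`.
If `|g(y) − g̃(y)| ≤ ‖y‖^(h−1)` for all `y` near `0`, then for all `x ≠ 0` near `0` and
all `y` with `‖y − x‖ < ‖x‖^τ`: `g(y) > ‖x‖^β` implies `g̃(y) ≥ ‖x‖^(β+1)`. -/
theorem claim_lemma_3_7
    {n : ℕ} (g g' : EuclideanSpace ℝ (Fin n) → ℝ)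
    (β τ : ℝ) (hβ : 0 < β) (hτ : 1 < τ)
    (h : ℕ) (hh : β + 1 < (h : ℝ))
    (δ : ℝ) (hδ : 0 < δ)
    (hclose : ∀ y : EuclideanSpace ℝ (Fin n), ‖y‖ < δ → |g y - g' y| ≤ ‖y‖ ^ (h - 1)) :
    ∃ ε > 0, ∀ x : EuclideanSpace ℝ (Fin n), 0 < ‖x‖ → ‖x‖ < ε →
      ∀ y : EuclideanSpace ℝ (Fin n), ‖y - x‖ < ‖x‖ ^ τ →
        g y > ‖x‖ ^ β → g' y ≥ ‖x‖ ^ (β + 1) := by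
  obtain ⟨k, rfl⟩ : ∃ k, h = k + 1 := Nat.exists_eq_succ_of_ne_zero (by
    rintro rfl
    norm_num at hh
    linarith)
  simp only [Nat.add_sub_cancel] at hclose
  have hk : 0 < (k : ℝ) - β := by
    push_cast at hh
    linarith
  have hcont : ContinuousAt (fun r : ℝ => 2 ^ k * r ^ ((k : ℝ) - β) + r) 0 :=
    (continuousAt_const.mul (Real.continuousAt_rpow_const _ _ (Or.inr hk.le))).add continuousAt_id
  have hsmall : ∀ᶠ r : ℝ in nhds 0, 2 ^ k * r ^ ((k : ℝ) - β) + r < 1 :=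
    hcont.eventually_lt continuousAt_const (by simp [Real.zero_rpow hk.ne'])
  obtain ⟨ε, hε, hεsmall⟩ := Metric.eventually_nhds_iff.1 hsmall
  refine ⟨min ε (min 1 (δ / 2)), by positivity, fun x hx hxε y hy hgy => ?_⟩
  obtain ⟨hx₁, hx₂, hx₃⟩ : ‖x‖ < ε ∧ ‖x‖ < 1 ∧ ‖x‖ < δ / 2 := by simpa using hxε
  have hr := hεsmall (y := ‖x‖) (by simpa using hx₁)
  have hpow : ‖x‖ ^ τ ≤ ‖x‖ := by
    simpa using Real.rpow_le_rpow_of_exponent_ge hx hx₂.le hτ.le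
  have hy₂ : ‖y‖ ≤ 2 * ‖x‖ := by
    have := norm_le_norm_add_norm_sub' y x
    linarith
  have hdiff : g y - g' y ≤ (2 * ‖x‖) ^ k :=
    (le_abs_self _).trans ((hclose y (by linarith)).trans (by gcongr))
  have hfactor : (2 * ‖x‖) ^ k = ‖x‖ ^ β * (2 ^ k * ‖x‖ ^ ((k : ℝ) - β)) := by
    rw [Real.rpow_sub hx, Real.rpow_natCast, mul_pow]
    field_simp
  have hsum := mul_le_mul_of_nonneg_left hr.le (Real.rpow_nonneg hx.le β)
  rw [Real.rpow_add_one hx.ne']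
  linarith
end
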